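/- arXiv:1710.07255 — 4 statements merged into one kernel-verified Lean document; each statement's English description precedes it below -/
import Mathlib

section
/- Let k ≥ 4 be an even integer, let m ≥ 1, and let H be an induced subgraph of the torus C_k^m such that |V(H)| divides k^m. Then there exists a positive integer n₀ such that for every n ≥ n₀, the torus C_k^n admits a perfect induced H-packing. -/
/-- The torus `C_k^n`: vertices are functions `Fin n → ZMod k`, adjacent iff they differ
in exactly one coordinate, and in that coordinate by `±1 (mod k)`. -/
def torus (k n : ℕ) : SimpleGraph (Fin n → ZMod k) :=
  SimpleGraph.fromRel fun u v => ∃ i, u i - v i = 1 ∧ ∀ j, j ≠ i → u j = v j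

/-- `G` admits a perfect induced `H`-packing: a collection of pairwise vertex-disjoint
induced subgraphs of `G`, each isomorphic to `H`, covering all vertices of `G`. -/
def HasPerfectInducedPacking {V W : Type*} (G : SimpleGraph V) (H : SimpleGraph W) : Prop :=
  ∃ P : Set G.Subgraph,
    (∀ K ∈ P, K.IsInduced ∧ Nonempty (H ≃g K.coe)) ∧
    P.PairwiseDisjoint (fun K => K.verts) ∧
    ⋃ K ∈ P, K.verts = Set.univ

/-- `S` is a disjoint union of axis-parallel copies of members of `F`, with at most one copy on
each axis-parallel line: `σ j v` is the member of `F` used on the line through `v` in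
direction `j`. -/
def LineTileable {X κ : Type} (F : Set (Set X)) (S : Set (κ → X)) : Prop :=
  ∃ σ : κ → (κ → X) → Set X,
    (∀ j v w, (∀ i, i ≠ j → v i = w i) → σ j v = σ j w) ∧ (∀ j v, σ j v ∈ F) ∧
    (∀ v i j, v i ∈ σ i v → v j ∈ σ j v → i = j) ∧ ∀ v, v ∈ S ↔ ∃ j, v j ∈ σ j v

namespace LineTileable

variable {X κ κ₁ κ₂ : Type} {F : Set (Set X)}

lemma empty (h0 : ∅ ∈ F) : LineTileable F (∅ : Set (κ → X)) :=
  ⟨fun _ _ => ∅, by simp [h0]⟩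

lemma of_unit {A : Set X} (hA : A ∈ F) : LineTileable F {v : Unit → X | v () ∈ A} :=
  ⟨fun _ _ => A, fun _ _ _ _ => rfl, fun _ _ => hA, fun _ _ _ _ _ => rfl,
    fun _ => ⟨fun h => ⟨(), h⟩, fun ⟨_, h⟩ => h⟩⟩

lemma sum {S : Set (κ₁ ⊕ κ₂ → X)} (S₁ : (κ₂ → X) → Set (κ₁ → X))
    (S₂ : (κ₁ → X) → Set (κ₂ → X)) (h₁ : ∀ v, LineTileable F (S₁ v))
    (h₂ : ∀ u, LineTileable F (S₂ u)) (hd : ∀ u v, u ∈ S₁ v → v ∉ S₂ u)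
    (hS : ∀ w, w ∈ S ↔ w ∘ Sum.inl ∈ S₁ (w ∘ Sum.inr) ∨ w ∘ Sum.inr ∈ S₂ (w ∘ Sum.inl)) :
    LineTileable F S := by
  choose σ₁ a₁ b₁ c₁ d₁ using h₁
  choose σ₂ a₂ b₂ c₂ d₂ using h₂
  refine ⟨Sum.elim (fun j w => σ₁ (w ∘ Sum.inr) j (w ∘ Sum.inl))
    (fun j w => σ₂ (w ∘ Sum.inl) j (w ∘ Sum.inr)), ?_, ?_, ?_, ?_⟩
  · rintro (j | j) v w h
    · have : v ∘ Sum.inr = w ∘ Sum.inr := funext fun i => h _ (by simp)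
      simp only [Sum.elim_inl, this]
      exact a₁ _ _ _ _ fun i hi => h _ (by simpa using hi)
    · have : v ∘ Sum.inl = w ∘ Sum.inl := funext fun i => h _ (by simp)
      simp only [Sum.elim_inr, this]
      exact a₂ _ _ _ _ fun i hi => h _ (by simpa using hi)
  · rintro (j | j) v
    · exact b₁ _ _ _
    · exact b₂ _ _ _
  · rintro v (i | i) (j | j) hi hj
    · exact congrArg _ (c₁ _ _ _ _ hi hj)
    · exact absurd ((d₂ _ _).2 ⟨j, hj⟩) (hd _ _ ((d₁ _ _).2 ⟨i, hi⟩))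
    · exact absurd ((d₂ _ _).2 ⟨i, hi⟩) (hd _ _ ((d₁ _ _).2 ⟨j, hj⟩))
    · exact congrArg _ (c₂ _ _ _ _ hi hj)
  · intro w
    rw [hS, d₁, d₂, Sum.exists]
    rfl

/-- The points having at least one coordinate in `A`. -/
lemma exists_mem [Finite κ] (h0 : ∅ ∈ F) {A : Set X} (hA : A ∈ F) :
    LineTileable F {v : κ → X | ∃ j, v j ∈ A} := by
  classical
  obtain ⟨n, ⟨e⟩⟩ := Finite.exists_equiv_fin κ
  refine ⟨fun j v => if ∀ i, e i < e j → v i ∉ A then A else ∅, ?_, ?_, ?_, ?_⟩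
  · intro j v w h
    have : (∀ i, e i < e j → v i ∉ A) ↔ (∀ i, e i < e j → w i ∉ A) := by
      refine forall_congr' fun i => ?_
      by_cases hij : i = j
      · simp [hij]
      · rw [h i hij]
    simp only [this]
  · intro j v
    dsimp only
    split_ifs <;> assumption
  · intro v i j hi hj
    have key : ∀ i, v i ∈ (if ∀ l, e l < e i → v l ∉ A then A else ∅) →
        v i ∈ A ∧ ∀ l, e l < e i → v l ∉ A := by
      intro i hi
      split_ifs at hi with h
      · exact ⟨hi, h⟩
      · exact absurd hi (Set.notMem_empty _)
    obtain ⟨a, b⟩ := key i hi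
    obtain ⟨c, d⟩ := key j hj
    rcases lt_trichotomy (e i) (e j) with h | h | h
    · exact absurd a (d _ h)
    · exact e.injective h
    · exact absurd c (b _ h)
  · intro v
    constructor
    · rintro ⟨j, hj⟩
      have hne : (Finset.univ.filter fun l : Fin n => v (e.symm l) ∈ A).Nonempty :=
        ⟨e j, by simpa using hj⟩
      have hmin := Finset.min'_mem _ hne
      set l := Finset.min' _ hne with hl
      refine ⟨e.symm l, ?_⟩
      dsimp only
      rw [if_pos]
      · simpa using hmin
      · intro i hi hiA
        have := Finset.min'_le (Finset.univ.filter fun l : Fin n => v (e.symm l) ∈ A) (e i)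
          (by simpa using hiA)
        rw [Equiv.apply_symm_apply] at hi
        exact absurd hi (not_lt.2 this)
    · rintro ⟨j, hj⟩
      dsimp only at hj
      split_ifs at hj
      · exact ⟨j, hj⟩
      · exact absurd hj (Set.notMem_empty _)

/-- A tiling of `Z ^ κ` by traces on `Z` extends to a tileable subset of `X ^ κ`
containing `Z ^ κ`. -/
lemma extend_trace (h0 : ∅ ∈ F) {Z : Set X} (hZ : Z.Nonempty)
    (h : LineTileable ((fun B : Set X => (Subtype.val ⁻¹' B : Set Z)) '' F) (Set.univ : Set (κ → Z))) :
    ∃ K : Set (κ → X), LineTileable F K ∧ ∀ v, (∀ i, v i ∈ Z) → v ∈ K := by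
  classical
  obtain ⟨z₀, hz₀⟩ := hZ
  obtain ⟨σ, hσ, hF, hu, hc⟩ := h
  choose B hBF hB using hF
  let r : X → Z := fun x => if hx : x ∈ Z then ⟨x, hx⟩ else ⟨z₀, hz₀⟩
  have hr : ∀ x (hx : x ∈ Z), r x = ⟨x, hx⟩ := fun x hx => dif_pos hx
  let C : κ → (κ → Z) → Set X := fun j z =>
    if h : ∃ C ∈ F, Subtype.val ⁻¹' C = σ j z then h.choose else ∅
  have hC : ∀ j z, C j z ∈ F ∧ Subtype.val ⁻¹' (C j z) = σ j z := by
    intro j z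
    have h : ∃ C ∈ F, Subtype.val ⁻¹' C = σ j z := ⟨B j z, hBF j z, hB j z⟩
    simp only [C, dif_pos h]
    exact h.choose_spec
  have hCcongr : ∀ j z z', σ j z = σ j z' → C j z = C j z' := by
    intro j z z' h
    simp only [C, h]
  let τ : κ → (κ → X) → Set X := fun j v =>
    if ∀ i, i ≠ j → v i ∈ Z then C j (r ∘ v) else ∅
  have hτ : ∀ j v x, x ∈ τ j v → (∀ i, i ≠ j → v i ∈ Z) ∧ x ∈ C j (r ∘ v) := by
    intro j v x hx
    simp only [τ] at hx
    split_ifs at hx with h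
    · exact ⟨h, hx⟩
    · exact absurd hx (Set.notMem_empty _)
  have hmem : ∀ j v (hv : ∀ i, v i ∈ Z), v j ∈ C j (r ∘ v) ↔ r (v j) ∈ σ j (r ∘ v) := by
    intro j v hv
    rw [← (hC j (r ∘ v)).2, Set.mem_preimage, hr _ (hv j)]
  refine ⟨{v | ∃ j, v j ∈ τ j v}, ⟨τ, ?_, ?_, ?_, fun _ => Iff.rfl⟩, ?_⟩
  · intro j v w h
    have h1 : (∀ i, i ≠ j → v i ∈ Z) ↔ (∀ i, i ≠ j → w i ∈ Z) :=
      forall_congr' fun i => forall_congr' fun hi => by rw [h i hi]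
    have h2 : C j (r ∘ v) = C j (r ∘ w) :=
      hCcongr _ _ _ (hσ _ _ _ fun i hi => by simp [h i hi])
    simp only [τ, h1, h2]
  · intro j v
    simp only [τ]
    split_ifs
    · exact (hC _ _).1
    · exact h0
  · intro v i j hi hj
    by_contra hij
    obtain ⟨a, b⟩ := hτ _ _ _ hi
    obtain ⟨c, d⟩ := hτ _ _ _ hj
    have hv : ∀ l, v l ∈ Z := fun l => by
      by_cases hl : l = i
      · exact c l (hl ▸ hij)
      · exact a l hl
    exact hij (hu (r ∘ v) i j ((hmem i v hv).1 b) ((hmem j v hv).1 d))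
  · intro v hv
    obtain ⟨j, hj⟩ := (hc (r ∘ v)).1 trivial
    refine ⟨j, ?_⟩
    simp only [τ]
    rw [if_pos fun i _ => hv i]
    exact (hmem j v hv).2 hj

/-- From two disjoint sets with tileable complements one obtains arbitrarily many. -/
lemma exists_disjoint [Finite κ] (h0 : ∅ ∈ F) {E₁ E₂ : Set (κ → X)}
    (hd : Disjoint E₁ E₂) (h₁ : LineTileable F E₁ᶜ) (h₂ : LineTileable F E₂ᶜ) (q : ℕ) :
    ∃ (ι : Type) (_ : Finite ι) (E : ℕ → Set (ι → X)),
      (∀ i < q, LineTileable F (E i)ᶜ) ∧ ∀ i j, i < j → j < q → Disjoint (E i) (E j) := by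
  classical
  induction q with
  | zero => exact ⟨Empty, inferInstance, fun _ => ∅, by simp, by simp⟩
  | succ q ih =>
    obtain ⟨ι, _, E, hE, hdis⟩ := ih
    refine ⟨ι ⊕ κ, inferInstance, fun i => if i < q then
      {w | w ∘ Sum.inl ∈ E i ∧ w ∘ Sum.inr ∈ E₁} else {w | w ∘ Sum.inr ∈ E₂}, ?_, ?_⟩
    · intro i _
      by_cases hi : i < q
      · simp only [hi, if_true]
        refine sum (fun _ => (E i)ᶜ) (fun u => if u ∈ E i then E₁ᶜ else ∅) (fun _ => hE i hi)
          (fun u => ?_) ?_ ?_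
        · split_ifs
          · exact h₁
          · exact empty h0
        · intro u v hu
          simp [show u ∉ E i from hu]
        · intro w
          by_cases hw : w ∘ Sum.inl ∈ E i <;> simp [hw]
      · simp only [hi, if_false]
        exact sum (fun _ => ∅) (fun _ => E₂ᶜ) (fun _ => empty h0) (fun _ => h₂)
          (by simp) (by simp)
    · intro i j hij hj
      have hi : i < q := by omega
      simp only [hi, if_true]
      rw [Set.disjoint_left]
      by_cases hjq : j < q
      · simp only [hjq, if_true]
        rintro w ⟨hw, -⟩ ⟨hw', -⟩
        exact Set.disjoint_left.1 (hdis i j hij hjq) hw hw'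
      · simp only [hjq, if_false]
        rintro w ⟨-, hw⟩ hw'
        exact Set.disjoint_left.1 hd hw hw'

end LineTileable

namespace LineTileable

variable {X κ : Type} {F : Set (Set X)}

/-- If two disjoint sets have tileable complements and `X` is covered exactly `t` times by members
of `F`, some power of `X` has a labelling by `Fin (t + 1)` all of whose label classes have
tileable complements. -/
lemma exists_labelling [Finite κ] (h0 : ∅ ∈ F) {I : Type} [Finite I] {A : I → Set X}
    (hA : ∀ i, A i ∈ F) {t : ℕ} (ht : ∀ x, Nat.card {i // x ∈ A i} = t) {E₁ E₂ : Set (κ → X)}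
    (hd : Disjoint E₁ E₂) (h₁ : LineTileable F E₁ᶜ) (h₂ : LineTileable F E₂ᶜ) :
    ∃ (V : Type) (_ : Finite V) (lab : (V → X) → Fin (t + 1)),
      ∀ τ, LineTileable F {v | lab v ≠ τ} := by
  classical
  obtain ⟨p, ⟨e⟩⟩ := Finite.exists_equiv_fin I
  obtain ⟨ι, _, E', hE', hdis'⟩ := exists_disjoint h0 hd h₁ h₂ p
  let E : I → Set (ι → X) := fun i => E' (e i)
  have hE : ∀ i, LineTileable F (E i)ᶜ := fun i => hE' _ (e i).2
  have hdis : ∀ i j y, y ∈ E i → y ∈ E j → i = j := by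
    intro i j y hi hj
    rcases lt_trichotomy (e i : ℕ) (e j) with h | h | h
    · exact absurd hj (Set.disjoint_left.1 (hdis' _ _ h (e j).2) hi)
    · exact e.injective (Fin.ext h)
    · exact absurd hi (Set.disjoint_left.1 (hdis' _ _ h (e i).2) hj)
  let g : ∀ x, {i // x ∈ A i} ≃ Fin t := fun x => Finite.equivFinOfCardEq (ht x)
  let lab : (Unit ⊕ ι → X) → Option (Fin t) := fun w =>
    if h : ∃ l, w ∘ Sum.inr ∈ E ((g (w (Sum.inl ()))).symm l) then some h.choose else none
  have hsome : ∀ w l, lab w = some l ↔ w ∘ Sum.inr ∈ E ((g (w (Sum.inl ()))).symm l) := by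
    intro w l
    by_cases h : ∃ l, w ∘ Sum.inr ∈ E ((g (w (Sum.inl ()))).symm l)
    · simp only [lab, dif_pos h, Option.some_inj]
      constructor
      · rintro rfl
        exact h.choose_spec
      · intro hl
        have := hdis _ _ _ h.choose_spec hl
        exact (g (w (Sum.inl ()))).symm.injective (Subtype.ext this)
    · simp only [lab, dif_neg h]
      simpa using fun hl => h ⟨l, hl⟩
  have hnone : ∀ w, lab w ≠ none ↔ ∃ i, w (Sum.inl ()) ∈ A i ∧ w ∘ Sum.inr ∈ E i := by
    intro w
    rw [Option.ne_none_iff_exists']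
    constructor
    · rintro ⟨l, hl⟩
      exact ⟨_, ((g (w (Sum.inl ()))).symm l).2, (hsome _ _).1 hl⟩
    · rintro ⟨i, hi, hw⟩
      exact ⟨g _ ⟨i, hi⟩, (hsome _ _).2 (by simpa using hw)⟩
  have key : ∀ τ, LineTileable F {v | lab v ≠ τ} := by
    intro τ
    cases τ with
    | none =>
      refine sum (fun y => if h : ∃ i, y ∈ E i then {u | u () ∈ A h.choose} else ∅) (fun _ => ∅)
        (fun y => ?_) (fun _ => empty h0) (by simp) fun w => ?_
      · split_ifs with h
        · exact of_unit (hA _)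
        · exact empty h0
      · rw [Set.mem_ofPred_eq, hnone]
        split_ifs with h
        · simp only [Set.mem_ofPred_eq, Set.mem_empty_iff_false, or_false, Function.comp]
          constructor
          · rintro ⟨i, hi, hw⟩
            rwa [hdis _ _ _ h.choose_spec hw]
          · exact fun hw => ⟨_, hw, h.choose_spec⟩
        · simp only [Set.mem_empty_iff_false, or_false, iff_false]
          rintro ⟨i, -, hi⟩
          exact h ⟨i, hi⟩
    | some l =>
      refine sum (fun _ => ∅) (fun u => (E ((g (u ())).symm l))ᶜ) (fun _ => empty h0)
        (fun _ => hE _) (by simp) fun w => ?_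
      rw [Set.mem_ofPred_eq, Ne, hsome]
      simp
  refine ⟨Unit ⊕ ι, inferInstance, fun w => (finSuccEquiv t).symm (lab w), fun τ => ?_⟩
  have := key (finSuccEquiv t τ)
  simpa only [Ne, Equiv.symm_apply_eq] using this

/-- Given a labelling by `t + 1` labels, there are sets indexed by `J` such that for every `S ⊆ J`
with `|S| ≡ 1` modulo `t` all of whose `(t + 1)`-tuples lie in `𝒩`, the sets indexed by `S` are
pairwise disjoint and the complement of their union is tileable. -/
lemma exists_separated (h0 : ∅ ∈ F) {V : Type} [Finite V] {t : ℕ} (ht : 1 ≤ t)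
    (lab : (V → X) → Fin (t + 1)) (hlab : ∀ τ, LineTileable F {v | lab v ≠ τ})
    {J : Type} [DecidableEq J] (𝒩 : Finset (Fin (t + 1) ↪ J)) :
    ∃ (κ : Type) (_ : Finite κ) (B : J → Set (κ → X)), ∀ S : Finset J,
      (∃ a, S.card = 1 + t * a) → (∀ N : Fin (t + 1) ↪ J, (∀ l, N l ∈ S) → N ∈ 𝒩) →
      (∀ i ∈ S, ∀ j ∈ S, ∀ u, u ∈ B i → u ∈ B j → i = j) ∧
        LineTileable F {u | ∀ i ∈ S, u ∉ B i} := by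
  classical
  induction 𝒩 using Finset.induction with
  | empty =>
    refine ⟨Empty, inferInstance, fun _ => Set.univ, fun S ⟨a, ha⟩ hS => ?_⟩
    have hcard : S.card < t + 1 := by
      by_contra! h
      obtain ⟨T, hT, hTc⟩ := Finset.exists_subset_card_eq h
      let e := (T.equivFinOfCardEq hTc).symm
      exact absurd (hS ⟨fun l => (e l : J), fun a b h => e.injective (Subtype.ext h)⟩
        fun l => hT (e l).2) (Finset.notMem_empty _)
    have h1 : S.card = 1 := by
      rcases Nat.eq_zero_or_pos a with rfl | h
      · simpa using ha
      · nlinarith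
    obtain ⟨s, rfl⟩ := Finset.card_eq_one.1 h1
    refine ⟨by simp, ?_⟩
    convert empty h0
    simp
  | insert N 𝒩 _ ih =>
    obtain ⟨κ, _, B, hB⟩ := ih
    let c : J → Fin (t + 1) := fun i => if h : ∃ l, N l = i then h.choose else 0
    have hcN : ∀ l, c (N l) = l := by
      intro l
      have h : ∃ l', N l' = N l := ⟨l, rfl⟩
      simp only [c, dif_pos h]
      exact N.injective h.choose_spec
    have hc0 : ∀ i, (∀ l, N l ≠ i) → c i = 0 := by
      intro i hi
      have h : ¬ ∃ l, N l = i := by simpa using hi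
      simp only [c, dif_neg h]
    refine ⟨V ⊕ κ, inferInstance, fun i => {w | lab (w ∘ Sum.inl) = c i ∧ w ∘ Sum.inr ∈ B i},
      fun S ⟨a, ha⟩ hS => ?_⟩
    by_cases hN : ∀ l, N l ∈ S
    · let C : Finset J := S.filter fun i => ∀ l, N l ≠ i
      have hCN : ∀ l, N l ∉ C := fun l h => (Finset.mem_filter.1 h).2 l rfl
      have hcases : ∀ i ∈ S, i ∈ C ∨ ∃ l, N l = i := by
        intro i hi
        by_cases h : ∃ l, N l = i
        · exact Or.inr h
        · exact Or.inl (Finset.mem_filter.2 ⟨hi, by simpa using h⟩)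
      have hCS : ∀ i ∈ C, i ∈ S := fun i hi => (Finset.mem_filter.1 hi).1
      have hCc : ∀ i ∈ C, c i = 0 := fun i hi => hc0 i (Finset.mem_filter.1 hi).2
      have hSC : S.card = C.card + (t + 1) := by
        have h1 : S = C ∪ Finset.univ.map N := by
          ext i
          simp only [Finset.mem_union, Finset.mem_map, Finset.mem_univ, true_and]
          refine ⟨hcases i, ?_⟩
          rintro (h | ⟨l, rfl⟩)
          · exact hCS i h
          · exact hN l
        have h2 : Disjoint C (Finset.univ.map N) := by
          rw [Finset.disjoint_right]
          intro i hi
          obtain ⟨l, -, rfl⟩ := Finset.mem_map.1 hi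
          exact hCN l
        rw [h1, Finset.card_union_of_disjoint h2]
        simp
      have hl : ∀ l, (∀ i ∈ insert (N l) C, ∀ j ∈ insert (N l) C, ∀ u, u ∈ B i → u ∈ B j → i = j) ∧
          LineTileable F {u | ∀ i ∈ insert (N l) C, u ∉ B i} := by
        intro l
        refine hB _ ⟨a - 1, ?_⟩ fun N' hN' => ?_
        · rw [Finset.card_insert_of_notMem (hCN l)]
          cases a with
          | zero => omega
          | succ a =>
            rw [Nat.add_sub_cancel]
            rw [Nat.mul_succ] at ha
            omega
        · have h1 : N' ∈ insert N 𝒩 := hS N' fun l' => by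
            rcases Finset.mem_insert.1 (hN' l') with h | h
            · exact h ▸ hN l
            · exact hCS _ h
          rcases Finset.mem_insert.1 h1 with rfl | h
          · exfalso
            have : Nontrivial (Fin (t + 1)) := Fin.nontrivial_iff_two_le.2 (by omega)
            obtain ⟨l', hl'⟩ := exists_ne l
            rcases Finset.mem_insert.1 (hN' l') with h | h
            · exact hl' (N'.injective h)
            · exact hCN _ h
          · exact h
      refine ⟨?_, ?_⟩
      · rintro i hi j hj w ⟨hi1, hi2⟩ ⟨hj1, hj2⟩
        rcases hcases i hi with hi' | ⟨l, rfl⟩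
        · rcases hcases j hj with hj' | ⟨l, rfl⟩
          · exact (hl 0).1 i (Finset.mem_insert_of_mem hi') j (Finset.mem_insert_of_mem hj') _ hi2 hj2
          · exact (hl l).1 i (Finset.mem_insert_of_mem hi') _ (Finset.mem_insert_self _ _) _ hi2 hj2
        · rcases hcases j hj with hj' | ⟨l', rfl⟩
          · exact (hl l).1 _ (Finset.mem_insert_self _ _) j (Finset.mem_insert_of_mem hj') _ hi2 hj2
          · rw [hcN] at hi1 hj1
            rw [← hi1, ← hj1]
      · refine sum (fun q => if ∃ i ∈ C, q ∈ B i then {v | lab v ≠ 0} else ∅)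
          (fun v => {q | ∀ i ∈ insert (N (lab v)) C, q ∉ B i}) (fun q => ?_) (fun v => (hl _).2)
          (fun v q hv => ?_) fun w => ?_
        · split_ifs
          · exact hlab _
          · exact empty h0
        · split_ifs at hv with h
          · obtain ⟨i, hi, hq⟩ := h
            exact fun h' => h' i (Finset.mem_insert_of_mem hi) hq
          · exact absurd hv (Set.notMem_empty _)
        · constructor
          · intro hw
            by_cases h : ∃ i ∈ C, w ∘ Sum.inr ∈ B i
            · rw [if_pos h]
              obtain ⟨i, hi, hq⟩ := h
              exact Or.inl fun h => hw i (hCS i hi) ⟨by rw [h, hCc i hi], hq⟩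
            · refine Or.inr fun i hi hq => ?_
              rcases Finset.mem_insert.1 hi with rfl | hi
              · exact hw _ (hN _) ⟨(hcN _).symm, hq⟩
              · exact h ⟨i, hi, hq⟩
          · intro hw i hi hq
            obtain ⟨hq1, hq2⟩ := hq
            rcases hw with hw | hw
            · split_ifs at hw with h
              · obtain ⟨i', hi', hq'⟩ := h
                rcases hcases i hi with hi'' | ⟨l, rfl⟩
                · exact hw (by rw [hq1, hCc i hi''])
                · have := (hl l).1 _ (Finset.mem_insert_self _ _) _
                    (Finset.mem_insert_of_mem hi') _ hq2 hq'
                  exact hCN l (this ▸ hi')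
              · exact absurd hw (Set.notMem_empty _)
            · rcases hcases i hi with hi' | ⟨l, rfl⟩
              · exact hw i (Finset.mem_insert_of_mem hi') hq2
              · rw [hcN] at hq1
                exact hw (N l) (by rw [hq1]; exact Finset.mem_insert_self _ _) hq2
    · obtain ⟨hdis, htile⟩ := hB S ⟨a, ha⟩ fun N' hN' => by
        rcases Finset.mem_insert.1 (hS N' hN') with rfl | h
        · exact absurd hN' hN
        · exact h
      refine ⟨fun i hi j hj w hwi hwj => hdis i hi j hj _ hwi.2 hwj.2, ?_⟩
      refine sum (fun q => if h : ∃ i ∈ S, q ∈ B i then {v | lab v ≠ c h.choose} else ∅)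
          (fun _ => {q | ∀ i ∈ S, q ∉ B i}) (fun q => ?_) (fun v => htile)
          (fun v q hv => ?_) fun w => ?_
      · split_ifs
        · exact hlab _
        · exact empty h0
      · split_ifs at hv with h
        · exact fun h' => h' _ h.choose_spec.1 h.choose_spec.2
        · exact absurd hv (Set.notMem_empty _)
      · split_ifs with h
        · have hcs := h.choose_spec
          constructor
          · exact fun hw => Or.inl fun h' => hw _ hcs.1 ⟨h', hcs.2⟩
          · rintro (hw | hw) i hi ⟨h1, h2⟩
            · exact hw (by rw [h1, hdis _ hcs.1 _ hi _ hcs.2 h2])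
            · exact hw i hi h2
        · constructor
          · exact fun _ => Or.inr fun i hi hq => h ⟨i, hi, hq⟩
          · exact fun _ i hi hq => h ⟨i, hi, hq.2⟩

end LineTileable

namespace LineTileable

variable {X κ : Type} {F : Set (Set X)}

lemma exists_univ_of_labelling [Nonempty X] (h0 : ∅ ∈ F) {t : ℕ} (ht : 1 ≤ t) {I J : Type}
    [Finite I] [Finite J] {A : I → Set X} (hA : ∀ i, A i ∈ F)
    (hAt : ∀ x, Nat.card {i // x ∈ A i} = t) {P : J → Set X} (hP : ∀ j, P j ∈ F)
    (hPt : ∀ x, Nat.card {j // x ∈ P j} ≡ 1 [MOD t]) {V : Type} [Finite V]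
    (lab : (V → X) → Fin (t + 1)) (hlab : ∀ τ, LineTileable F {v | lab v ≠ τ}) :
    ∃ (κ : Type) (_ : Finite κ), LineTileable F (Set.univ : Set (κ → X)) := by
  classical
  have := Fintype.ofFinite I
  have := Fintype.ofFinite J
  let Q : J ⊕ I ⊕ I → Set X := Sum.elim P (Sum.elim A A)
  have hQ : ∀ i, Q i ∈ F := by
    rintro (i | i | i)
    exacts [hP i, hA i, hA i]
  let D : X → Finset (J ⊕ I ⊕ I) := fun x => Finset.univ.filter fun i => x ∈ Q i
  have hD : ∀ x, (D x).card = Nat.card {j // x ∈ P j} + 2 * t := by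
    intro x
    have h1 : (D x).card = Nat.card {i // x ∈ Q i} := by
      rw [Nat.card_eq_fintype_card, Fintype.card_subtype]
    rw [h1, Nat.card_congr (Equiv.subtypeSum (p := fun i => x ∈ Q i)), Nat.card_sum,
      Nat.card_congr (Equiv.subtypeSum (p := fun i => x ∈ Q (Sum.inr i))), Nat.card_sum]
    change Nat.card {j // x ∈ P j} + (Nat.card {i // x ∈ A i} + Nat.card {i // x ∈ A i}) = _
    rw [hAt]
    ring
  have hD1 : ∀ x, ∃ a, (D x).card = 1 + t * a := by
    intro x
    have h1 : 1 ≡ (D x).card [MOD t] := by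
      rw [hD]
      exact ((hPt x).add (Nat.modEq_zero_iff_dvd.2 (Dvd.intro_left 2 rfl))).symm
    obtain ⟨a, ha⟩ := (Nat.modEq_iff_dvd' (by rw [hD]; omega)).1 h1
    exact ⟨a, by have := hD x; omega⟩
  obtain ⟨κ, _, B, hB⟩ := exists_separated h0 ht lab hlab (Finset.univ : Finset (Fin (t + 1) ↪ J ⊕ I ⊕ I))
  have hdis : ∀ i j q, q ∈ B i → q ∈ B j → i = j := by
    intro i j q hi hj
    by_contra hij
    obtain ⟨x⟩ := ‹Nonempty X›
    have hle : t + 1 ≤ (Finset.univ : Finset (J ⊕ I ⊕ I)).card := by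
      refine le_trans ?_ (Finset.card_le_card (Finset.subset_univ (D x)))
      rw [hD]
      omega
    obtain ⟨S, hS, -, hSc⟩ := Finset.exists_subsuperset_card_eq (Finset.subset_univ {i, j})
      (by rw [Finset.card_pair hij]; omega) hle
    exact hij ((hB S ⟨1, by omega⟩ fun _ _ => Finset.mem_univ _).1 i (hS (by simp)) j
      (hS (by simp)) q hi hj)
  refine ⟨Unit ⊕ κ, inferInstance, sum
    (fun q => if h : ∃ i, q ∈ B i then {u | u () ∈ Q h.choose} else ∅)
    (fun u => {q | ∀ i ∈ D (u ()), q ∉ B i}) (fun q => ?_)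
    (fun u => (hB _ (hD1 _) fun _ _ => Finset.mem_univ _).2) (fun u q hu => ?_) fun w => ?_⟩
  · split_ifs
    · exact of_unit (hQ _)
    · exact empty h0
  · split_ifs at hu with h
    · exact fun h' => h' h.choose (Finset.mem_filter.2 ⟨Finset.mem_univ _, hu⟩) h.choose_spec
    · exact absurd hu (Set.notMem_empty _)
  · refine iff_of_true trivial ?_
    split_ifs with h
    · by_cases hw : w (Sum.inl ()) ∈ Q h.choose
      · exact Or.inl hw
      · refine Or.inr fun i hi hq => hw ?_
        rw [hdis _ _ _ h.choose_spec hq]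
        exact (Finset.mem_filter.1 hi).2
    · exact Or.inr fun i _ hq => h ⟨i, hq⟩

/-- If `X` is covered exactly `t` times by members of `F`, and `1` modulo `t` times by members
of `F`, then some power of `X` is tileable by axis-parallel copies of members of `F`. -/
theorem exists_univ {t : ℕ} (ht : 1 ≤ t) {I J : Type} [Finite I] [Finite J] (X : Type) [Finite X]
    (F : Set (Set X)) (h0 : ∅ ∈ F) (A : I → Set X) (hA : ∀ i, A i ∈ F)
    (hAt : ∀ x, Nat.card {i // x ∈ A i} = t) (P : J → Set X) (hP : ∀ j, P j ∈ F)
    (hPt : ∀ x, Nat.card {j // x ∈ P j} ≡ 1 [MOD t]) :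
    ∃ (κ : Type) (_ : Finite κ), LineTileable F (Set.univ : Set (κ → X)) := by
  induction hn : Nat.card X using Nat.strong_induction_on generalizing X with
  | _ n ih =>
    subst hn
    have of_mem : ∀ B ∈ F, B = Set.univ →
        ∃ (κ : Type) (_ : Finite κ), LineTileable F (Set.univ : Set (κ → X)) := by
      rintro B hB rfl
      exact ⟨Unit, inferInstance, by simpa using of_unit hB⟩
    rcases isEmpty_or_nonempty X with hX | hX
    · exact of_mem _ h0 (Subsingleton.elim _ _)
    obtain ⟨x⟩ := id hX
    have hpos : 0 < Nat.card {i // x ∈ A i} := by rw [hAt]; omega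
    obtain ⟨⟨i, hi⟩⟩ := (Nat.card_pos_iff.1 hpos).1
    rcases (A i)ᶜ.eq_empty_or_nonempty with hZ | hZ
    · exact of_mem _ (hA i) (Set.compl_empty_iff.1 hZ)
    obtain ⟨κ, _, hκ⟩ := ih _ (Finite.card_subtype_lt (p := (· ∈ (A i)ᶜ)) (x := x) (by simpa using hi))
      ((A i)ᶜ : Set X) ((fun B : Set X => (Subtype.val ⁻¹' B : Set ((A i)ᶜ : Set X))) '' F)
      ⟨∅, h0, rfl⟩ (fun j => Subtype.val ⁻¹' A j) (fun j => ⟨_, hA j, rfl⟩) (fun z => hAt z)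
      (fun j => Subtype.val ⁻¹' P j) (fun j => ⟨_, hP j, rfl⟩) (fun z => hPt z) rfl
    obtain ⟨K, hK, hZK⟩ := extend_trace h0 hZ hκ
    have hd : Disjoint {v : κ → X | ∀ j, v j ∈ (A i)ᶜ} Kᶜ :=
      Set.disjoint_left.2 fun v hv hv' => hv' (hZK v hv)
    have h₁ : LineTileable F {v : κ → X | ∀ j, v j ∈ (A i)ᶜ}ᶜ := by
      convert exists_mem (κ := κ) h0 (hA i) using 1
      ext v
      simp
    obtain ⟨V, _, lab, hlab⟩ := exists_labelling h0 hA hAt hd h₁ (by rwa [compl_compl])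
    exact exists_univ_of_labelling h0 ht hA hAt hP hPt lab hlab

end LineTileable

lemma ZMod.val_sub_one_sub_val {k : ℕ} (hk : 2 ≤ k) (x : ZMod k) :
    ((x - 1).val : ℤ) - x.val = (if x = 0 then (k : ℤ) else 0) - 1 := by
  have : NeZero k := ⟨by omega⟩
  have : Fact (1 < k) := ⟨by omega⟩
  by_cases hx : x = 0
  · subst hx
    have h : (-1 : ZMod k).val + 1 = k := by
      rw [ZMod.neg_val, if_neg one_ne_zero, ZMod.val_one]
      omega
    simp only [zero_sub, ZMod.val_zero, if_true]
    omega
  · have h1 : 1 ≤ x.val := Nat.one_le_iff_ne_zero.2 ((ZMod.val_ne_zero x).2 hx)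
    rw [ZMod.val_sub (by rwa [ZMod.val_one]), ZMod.val_one, if_neg hx]
    omega

/-- Weights on the unit edges of a torus of dimension `m + 1`, whose sums vanish over the edges
issuing from a point and equal `1` over the edges ending at a point. -/
lemma exists_edge_weights {k m h : ℕ} (hk : 2 ≤ k) (hdiv : h ∣ k ^ m) :
    ∃ c : (Option (Fin m) → ZMod k) → Option (Fin m) → ZMod h,
      (∀ p, ∑ i, c p i = 0) ∧ ∀ q, ∑ i, c (q - (Pi.single i 1 : Option (Fin m) → ZMod k)) i = 1 := by
  classical
  let α : (Fin m → ZMod k) → Fin m → ℤ := fun u j =>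
    -(k ^ (j : ℕ) * (if ∀ i : Fin m, i < j → u i = 0 then 1 else 0) * (u j).val)
  let g : (Fin m → ZMod k) → ℕ → ℤ := fun u j =>
    k ^ j * if ∀ i : Fin m, (i : ℕ) < j → u i = 0 then 1 else 0
  have hα : ∀ u j, α (u - Pi.single j 1) j - α u j = g u j - g u (j + 1) := by
    intro u j
    have h1 : (∀ i : Fin m, i < j → (u - Pi.single j 1 : Fin m → ZMod k) i = 0) ↔
        ∀ i : Fin m, i < j → u i = 0 := by
      refine forall_congr' fun i => forall_congr' fun hi => ?_
      simp [hi.ne]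
    have h2 : (∀ i : Fin m, (i : ℕ) < j + 1 → u i = 0) ↔
        (∀ i : Fin m, i < j → u i = 0) ∧ u j = 0 := by
      constructor
      · exact fun h => ⟨fun i hi => h i (Nat.lt_succ_of_lt hi), h j (Nat.lt_succ_self _)⟩
      · rintro ⟨h, h'⟩ i hi
        rcases (Nat.lt_succ_iff.1 hi).lt_or_eq with hi | hi
        · exact h i hi
        · rwa [Fin.ext hi]
    have h3 := ZMod.val_sub_one_sub_val hk (u j)
    simp only [α, g, h1, h2, ← Fin.lt_def]
    simp only [Pi.sub_apply, Pi.single_eq_same]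
    by_cases h4 : ∀ i : Fin m, i < j → u i = 0
    · by_cases h5 : u j = 0
      · rw [if_pos h4, if_pos ⟨h4, h5⟩]
        rw [if_pos h5] at h3
        rw [pow_succ]
        linear_combination (-(k : ℤ) ^ (j : ℕ)) * h3
      · rw [if_pos h4, if_neg fun h => h5 h.2]
        rw [if_neg h5] at h3
        linear_combination (-(k : ℤ) ^ (j : ℕ)) * h3
    · rw [if_neg h4, if_neg fun h => h4 h.1]
      ring
  have hsum : ∀ u, ∑ j, (α (u - Pi.single j 1) j - α u j) = 1 - g u m := by
    intro u
    simp only [hα]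
    rw [Fin.sum_univ_eq_sum_range (fun j => g u j - g u (j + 1)), Finset.sum_range_sub']
    simp [g]
  have hg : ∀ u, ((g u m : ℤ) : ZMod h) = 0 := by
    intro u
    have : ((k ^ m : ℕ) : ZMod h) = 0 := (ZMod.natCast_eq_zero_iff _ _).2 hdiv
    simp only [g]
    push_cast at this ⊢
    rw [this, zero_mul]
  refine ⟨fun p i => i.elim (-∑ j, (α (p ∘ some) j : ZMod h)) fun j => (α (p ∘ some) j : ZMod h),
    fun p => ?_, fun q => ?_⟩
  · simp [Fintype.sum_option]
  · have h1 : (q - Pi.single none 1 : Option (Fin m) → ZMod k) ∘ some = q ∘ some := by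
      ext i
      simp
    have h2 : ∀ j, (q - Pi.single (some j) 1 : Option (Fin m) → ZMod k) ∘ some =
        q ∘ some - Pi.single j 1 := by
      intro j
      ext i
      simp [Pi.single_apply]
    have h3 := congrArg (fun z : ℤ => (z : ZMod h)) (hsum (q ∘ some))
    simp only [Int.cast_sub, Int.cast_sum, Int.cast_one, hg, Finset.sum_sub_distrib] at h3
    simp only [Fintype.sum_option, Option.elim, h1, h2]
    linear_combination h3

/-- A weighted family of sets covering each point with total weight `1` modulo `h` gives a
genuine family. -/
lemma exists_family_of_weights {Y D : Type} [Fintype D] {h : ℕ} [NeZero h] (wt : D → ZMod h)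
    (S : D → Set Y) [∀ v d, Decidable (v ∈ S d)]
    (hS : ∀ v, ∑ d, (if v ∈ S d then wt d else 0) = 1) :
    ∃ (J : Type) (_ : Finite J) (P : J → Set Y), (∀ j, ∃ d, P j = S d) ∧
      ∀ v, Nat.card {j // v ∈ P j} ≡ 1 [MOD h] := by
  refine ⟨Σ d, Fin (wt d).val, inferInstance, fun j => S j.1, fun j => ⟨_, rfl⟩, fun v => ?_⟩
  rw [← ZMod.natCast_eq_natCast_iff, Nat.cast_one, ← hS v, Nat.card_eq_fintype_card,
    Fintype.card_subtype, Finset.card_filter, Fintype.sum_sigma, Nat.cast_sum]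
  refine Finset.sum_congr rfl fun d _ => ?_
  split_ifs <;> simp

/-- Adjacency in the torus with an arbitrary index set of coordinates. -/
def TorusAdj {k : ℕ} {ι : Type} (u v : ι → ZMod k) : Prop :=
  ∃ i, (u i - v i = 1 ∨ v i - u i = 1) ∧ ∀ j, j ≠ i → u j = v j

/-- Isomorphisms of a torus onto an induced subgraph of another torus. -/
def IsTorusEmbedding {k : ℕ} {ι ι' : Type} (φ : (ι → ZMod k) → ι' → ZMod k) : Prop :=
  Function.Injective φ ∧ ∀ u v, TorusAdj (φ u) (φ v) ↔ TorusAdj u v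

lemma torus_adj_iff {k n : ℕ} (hk : 4 ≤ k) (u v : Fin n → ZMod k) :
    (torus k n).Adj u v ↔ TorusAdj u v := by
  have : Fact (1 < k) := ⟨by omega⟩
  simp only [torus, SimpleGraph.fromRel_adj, TorusAdj]
  constructor
  · rintro ⟨-, ⟨i, h, h'⟩ | ⟨i, h, h'⟩⟩
    · exact ⟨i, Or.inl h, h'⟩
    · exact ⟨i, Or.inr h, fun j hj => (h' j hj).symm⟩
  · rintro ⟨i, h, h'⟩
    refine ⟨?_, ?_⟩
    · rintro rfl
      simp at h
    · rcases h with h | h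
      · exact Or.inl ⟨i, h, h'⟩
      · exact Or.inr ⟨i, h, fun j hj => (h' j hj).symm⟩

namespace IsTorusEmbedding

variable {k : ℕ} {ι ι' ι'' : Type}

lemma comp {φ : (ι' → ZMod k) → ι'' → ZMod k} {ψ : (ι → ZMod k) → ι' → ZMod k}
    (hφ : IsTorusEmbedding φ) (hψ : IsTorusEmbedding ψ) : IsTorusEmbedding (φ ∘ ψ) :=
  ⟨hφ.1.comp hψ.1, fun u v => (hφ.2 _ _).trans (hψ.2 u v)⟩

lemma add_right (g : ι → ZMod k) : IsTorusEmbedding fun u : ι → ZMod k => u + g :=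
  ⟨add_left_injective g, fun u v => by simp [TorusAdj]⟩

/-- A map that places the coordinates along an injection, up to translation, and is constant
elsewhere is an embedding. -/
lemma of_coordinates [Fact (1 < k)] (e : ι → ι') (he : Function.Injective e) (w : ι' → ZMod k)
    {φ : (ι → ZMod k) → ι' → ZMod k} (h1 : ∀ u s, φ u (e s) = w (e s) + u s)
    (h2 : ∀ u l, (∀ s, e s ≠ l) → φ u l = w l) : IsTorusEmbedding φ := by
  refine ⟨fun u v h => funext fun s => ?_, fun u v => ⟨?_, ?_⟩⟩
  · have := congrFun h (e s)
    rw [h1, h1] at this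
    exact add_left_cancel this
  · rintro ⟨l, hl, hl'⟩
    by_cases h : ∃ s, e s = l
    · obtain ⟨s, rfl⟩ := h
      refine ⟨s, by simpa [h1] using hl, fun j hj => ?_⟩
      simpa [h1] using hl' (e j) (he.ne hj)
    · have h : ∀ s, e s ≠ l := by simpa using h
      rw [h2 _ _ h, h2 _ _ h, sub_self] at hl
      simp at hl
  · rintro ⟨s, hs, hs'⟩
    refine ⟨e s, by simpa [h1] using hs, fun l hl => ?_⟩
    by_cases h : ∃ s, e s = l
    · obtain ⟨s', rfl⟩ := h
      rw [h1, h1, hs' s' fun h => hl (h ▸ rfl)]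
    · have h : ∀ s, e s ≠ l := by simpa using h
      rw [h2 _ _ h, h2 _ _ h]

lemma pi {β : Type} {f : ι → ZMod k → β → ZMod k} (hf : ∀ i, Function.Injective (f i))
    (hf' : ∀ i x y, TorusAdj (f i x) (f i y) ↔ x - y = 1 ∨ y - x = 1) :
    IsTorusEmbedding fun (u : ι → ZMod k) (l : ι × β) => f l.1 (u l.1) l.2 := by
  refine ⟨fun u v h => funext fun i => hf i (funext fun b => congrFun h (i, b)), fun u v => ?_⟩
  constructor
  · rintro ⟨⟨i, b⟩, h, h'⟩
    refine ⟨i, (hf' _ _ _).1 ⟨b, h, fun b' hb => h' (i, b') (by simpa using hb)⟩, fun j hj => ?_⟩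
    exact hf j (funext fun b' => h' (j, b') (by simp [hj]))
  · rintro ⟨i, h, h'⟩
    obtain ⟨b, hb, hb'⟩ := (hf' i _ _).2 h
    refine ⟨(i, b), hb, ?_⟩
    rintro ⟨j, b'⟩ hj
    by_cases hji : j = i
    · subst hji
      exact hb' b' (by simpa using hj)
    · simp only [h' j hji]

end IsTorusEmbedding

/-- The embedding of an even cycle `C_{2r}` into a three-dimensional torus: the first two
coordinates are both `1` at the point `r` only. -/
def foldCycle {k : ℕ} (r : ℕ) (x : ZMod k) : Unit ⊕ Unit ⊕ Unit → ZMod k :=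
  Sum.elim (fun _ => ((if 1 ≤ x.val ∧ x.val ≤ r then 1 else 0 : ℕ) : ZMod k))
    (Sum.elim (fun _ => ((if r ≤ x.val then 1 else 0 : ℕ) : ZMod k))
      fun _ => ((if x.val < r then x.val - 1 else if x.val = r then r - 2 else
        2 * r - 1 - x.val : ℕ) : ZMod k))

lemma foldCycle_spec {k r : ℕ} (hk : 4 ≤ k) (hr : k = 2 * r) :
    Function.Injective (foldCycle (k := k) r) ∧
      ∀ x y : ZMod k, TorusAdj (foldCycle r x) (foldCycle r y) ↔ x - y = 1 ∨ y - x = 1 := by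
  have : NeZero k := ⟨by omega⟩
  have heq : ∀ p q : ℕ, p < k → q < k → ((p : ZMod k) = q ↔ p = q) := by
    intro p q hp hq
    rw [ZMod.natCast_eq_natCast_iff', Nat.mod_eq_of_lt hp, Nat.mod_eq_of_lt hq]
  have hsub : ∀ p q : ℕ, p < k → q + 1 < k → ((p : ZMod k) - q = 1 ↔ p = q + 1) := by
    intro p q hp hq
    rw [← heq p (q + 1) hp hq, sub_eq_iff_eq_add, Nat.cast_add, Nat.cast_one, add_comm]
  have hval : ∀ x y : ZMod k, x - y = 1 ↔ x.val = y.val + 1 ∨ x.val = 0 ∧ y.val + 1 = k := by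
    intro x y
    have hx := x.val_lt
    have hy := y.val_lt
    have h1 : x - y = 1 ↔ (x.val : ZMod k) = (y.val + 1 : ℕ) := by
      rw [Nat.cast_add, ZMod.natCast_zmod_val, ZMod.natCast_zmod_val, sub_eq_iff_eq_add,
        Nat.cast_one, add_comm]
    rw [h1, ZMod.natCast_eq_natCast_iff', Nat.mod_eq_of_lt hx]
    rcases Nat.lt_or_ge (y.val + 1) k with h | h
    · rw [Nat.mod_eq_of_lt h]
      omega
    · rw [show y.val + 1 = k by omega, Nat.mod_self]
      omega
  have ha : ∀ i : ℕ, (if 1 ≤ i ∧ i ≤ r then 1 else 0) + 1 < k := by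
    intro i
    split_ifs <;> omega
  have hb : ∀ i : ℕ, (if r ≤ i then 1 else 0) + 1 < k := by
    intro i
    split_ifs <;> omega
  have hc : ∀ i : ℕ, (if i < r then i - 1 else if i = r then r - 2 else 2 * r - 1 - i) + 1 < k := by
    intro i
    split_ifs <;> omega
  have ha' := fun i => Nat.lt_of_succ_lt (ha i)
  have hb' := fun i => Nat.lt_of_succ_lt (hb i)
  have hc' := fun i => Nat.lt_of_succ_lt (hc i)
  constructor
  · intro x y h
    have h1 := (heq _ _ (ha' _) (ha' _)).1 (congrFun h (Sum.inl ()))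
    have h2 := (heq _ _ (hb' _) (hb' _)).1 (congrFun h (Sum.inr (Sum.inl ())))
    have h3 := (heq _ _ (hc' _) (hc' _)).1 (congrFun h (Sum.inr (Sum.inr ())))
    have hx := x.val_lt
    have hy := y.val_lt
    apply ZMod.val_injective k
    generalize x.val = i at *
    generalize y.val = j at *
    split_ifs at h1 h2 h3 <;> omega
  · intro x y
    have hx := x.val_lt
    have hy := y.val_lt
    rw [hval, hval]
    simp only [TorusAdj, Sum.exists, Sum.forall, foldCycle, Sum.elim_inl, Sum.elim_inr, ne_eq,
      Sum.inr.injEq, reduceCtorEq, false_imp_iff, true_and, and_true, not_false_eq_true, forall_const, not_true,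
      exists_const, hsub _ _ (ha' _) (ha _), hsub _ _ (hb' _) (hb _), hsub _ _ (hc' _) (hc _),
      heq _ _ (ha' _) (ha' _), heq _ _ (hb' _) (hb' _), heq _ _ (hc' _) (hc' _)]
    generalize x.val = i at *
    generalize y.val = j at *
    clear hsub heq hval ha hb hc ha' hb' hc'
    split_ifs <;>
      simp only [false_and, and_false, or_false, false_or, true_and, and_true, false_iff,
        true_iff] <;> omega

/-- The path that `foldCycle` describes, placed in a larger torus: the first two coordinates run
along the directions `d.1.2` and `d.2.1.2`. -/
def foldAt {k : ℕ} {ι : Type} [DecidableEq ι] (r : ℕ)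
    (d : ((ι → ZMod k) × ι) × ((ι → ZMod k) × ι) × ZMod k) (x : ZMod k) : ι ⊕ ι ⊕ Unit → ZMod k :=
  Sum.elim (d.1.1 + Pi.single d.1.2 (foldCycle r x (Sum.inl ())))
    (Sum.elim (d.2.1.1 + Pi.single d.2.1.2 (foldCycle r x (Sum.inr (Sum.inl ()))))
      fun _ => d.2.2 + foldCycle r x (Sum.inr (Sum.inr ())))

lemma foldAt_spec {k r : ℕ} {ι : Type} [DecidableEq ι] (hk : 4 ≤ k) (hr : k = 2 * r)
    (d : ((ι → ZMod k) × ι) × ((ι → ZMod k) × ι) × ZMod k) :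
    Function.Injective (foldAt r d) ∧
      ∀ x y : ZMod k, TorusAdj (foldAt r d x) (foldAt r d y) ↔ x - y = 1 ∨ y - x = 1 := by
  have : Fact (1 < k) := ⟨by omega⟩
  let ψ : (Unit ⊕ Unit ⊕ Unit → ZMod k) → ι ⊕ ι ⊕ Unit → ZMod k := fun u =>
    Sum.elim (d.1.1 + Pi.single d.1.2 (u (Sum.inl ())))
      (Sum.elim (d.2.1.1 + Pi.single d.2.1.2 (u (Sum.inr (Sum.inl ()))))
        fun _ => d.2.2 + u (Sum.inr (Sum.inr ())))
  have hψ : IsTorusEmbedding ψ := by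
    refine IsTorusEmbedding.of_coordinates
      (Sum.map (fun _ => d.1.2) (Sum.map (fun _ => d.2.1.2) id)) ?_
      (Sum.elim d.1.1 (Sum.elim d.2.1.1 fun _ => d.2.2)) ?_ ?_
    · exact (Function.injective_of_subsingleton _).sumMap
        ((Function.injective_of_subsingleton _).sumMap Function.injective_id)
    · rintro u (s | s | s) <;> simp [ψ]
    · rintro u (l | l | l) h
      · have := h (Sum.inl ())
        simp [ψ, show l ≠ d.1.2 by rintro rfl; simp at this]
      · have := h (Sum.inr (Sum.inl ()))
        simp [ψ, show l ≠ d.2.1.2 by rintro rfl; simp at this]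
      · exact absurd rfl (h (Sum.inr (Sum.inr l)))
  obtain ⟨h1, h2⟩ := foldCycle_spec hk hr
  exact ⟨hψ.1.comp h1, fun x y => (hψ.2 _ _).trans (h2 x y)⟩

/-- The weight of a placement of the folded cycle. -/
def foldWeight {k h : ℕ} {ι : Type} (c : (ι → ZMod k) → ι → ZMod h)
    (d : ((ι → ZMod k) × ι) × ((ι → ZMod k) × ι) × ZMod k) : ZMod h :=
  c d.1.1 d.1.2 * c d.2.1.1 d.2.1.2

lemma sum_edge_weights {k h : ℕ} [NeZero k] {ι : Type} [Fintype ι] [DecidableEq ι]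
    {c : (ι → ZMod k) → ι → ZMod h} (hc₀ : ∀ p, ∑ i, c p i = 0)
    (hc₁ : ∀ q, ∑ i, c (q - (Pi.single i 1 : ι → ZMod k)) i = 1) (v : ι → ZMod k) (p : Prop)
    [Decidable p] :
    (∑ d : (ι → ZMod k) × ι, if d.1 + Pi.single d.2 ((if p then 1 else 0 : ℕ) : ZMod k) = v
      then c d.1 d.2 else 0) = if p then 1 else 0 := by
  rw [Fintype.sum_prod_type_right]
  simp only [← eq_sub_iff_add_eq, Finset.sum_ite_eq', Finset.mem_univ, if_true]
  split_ifs
  · simpa using hc₁ v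
  · simpa using hc₀ v

lemma sum_prod_mul_mul {α β γ R : Type} [Fintype α] [Fintype β] [Fintype γ] [CommSemiring R]
    (f : α → R) (g : β → R) (w : γ → R) :
    ∑ d : α × β × γ, f d.1 * (g d.2.1 * w d.2.2) = (∑ a, f a) * ((∑ b, g b) * ∑ c, w c) := by
  simp only [Fintype.sum_prod_type, ← Finset.mul_sum, ← Finset.sum_mul]

lemma sum_foldWeight {k r h : ℕ} [NeZero k] (hk : 4 ≤ k) (hr : k = 2 * r) {ι : Type} [Fintype ι]
    [DecidableEq ι] {c : (ι → ZMod k) → ι → ZMod h} (hc₀ : ∀ p, ∑ i, c p i = 0)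
    (hc₁ : ∀ q, ∑ i, c (q - (Pi.single i 1 : ι → ZMod k)) i = 1) (x : ZMod k)
    (v : ι ⊕ ι ⊕ Unit → ZMod k) :
    (∑ d, if foldAt r d x = v then foldWeight c d else 0) = if x = r then 1 else 0 := by
  let f : (ι → ZMod k) × ι → ZMod h := fun a => if a.1 + (Pi.single a.2
    ((if 1 ≤ x.val ∧ x.val ≤ r then 1 else 0 : ℕ) : ZMod k) : ι → ZMod k) = v ∘ Sum.inl
    then c a.1 a.2 else 0
  let g : (ι → ZMod k) × ι → ZMod h := fun a => if a.1 + (Pi.single a.2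
    ((if r ≤ x.val then 1 else 0 : ℕ) : ZMod k) : ι → ZMod k) = v ∘ Sum.inr ∘ Sum.inl
    then c a.1 a.2 else 0
  let w : ZMod k → ZMod h := fun a =>
    if a + foldCycle r x (Sum.inr (Sum.inr ())) = v (Sum.inr (Sum.inr ())) then 1 else 0
  have hf : ∑ a, f a = if 1 ≤ x.val ∧ x.val ≤ r then 1 else 0 := sum_edge_weights hc₀ hc₁ _ _
  have hg : ∑ a, g a = if r ≤ x.val then 1 else 0 := sum_edge_weights hc₀ hc₁ _ _
  have hw : ∑ a, w a = 1 := by simp [w, ← eq_sub_iff_add_eq]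
  have h1 : ∀ d, (if foldAt r d x = v then foldWeight c d else 0) =
      f d.1 * (g d.2.1 * w d.2.2) := by
    intro d
    simp only [f, g, w]
    rw [ite_zero_mul_ite_zero, ite_zero_mul_ite_zero, foldWeight, mul_one]
    refine if_congr ?_ rfl rfl
    constructor
    · rintro rfl
      exact ⟨rfl, rfl, rfl⟩
    · rintro ⟨h1, h2, h3⟩
      funext l
      rcases l with l | l | l
      exacts [congrFun h1 l, congrFun h2 l, h3]
  rw [Finset.sum_congr rfl fun d _ => h1 d, sum_prod_mul_mul, hf, hg, hw, mul_one,
    ite_zero_mul_ite_zero, mul_one]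
  have h2 : x = r ↔ x.val = r := by
    rw [← (ZMod.val_injective k).eq_iff, ZMod.val_natCast, Nat.mod_eq_of_lt (by omega)]
  refine if_congr ?_ rfl rfl
  rw [h2]
  omega

/-- A product of folded cycles, translated so that the special point is `x₀`. -/
def foldTorus {k m : ℕ} {ι : Type} [DecidableEq ι] (r : ℕ) (x₀ : Fin m → ZMod k)
    (d : Fin m → ((ι → ZMod k) × ι) × ((ι → ZMod k) × ι) × ZMod k) (x : Fin m → ZMod k) :
    Fin m × (ι ⊕ ι ⊕ Unit) → ZMod k :=
  fun l => foldAt r (d l.1) (x l.1 + (r - x₀ l.1)) l.2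

lemma foldTorus_isTorusEmbedding {k r m : ℕ} {ι : Type} [DecidableEq ι] (hk : 4 ≤ k)
    (hr : k = 2 * r) (x₀ : Fin m → ZMod k)
    (d : Fin m → ((ι → ZMod k) × ι) × ((ι → ZMod k) × ι) × ZMod k) :
    IsTorusEmbedding (foldTorus r x₀ d) :=
  (IsTorusEmbedding.pi (fun i => (foldAt_spec hk hr (d i)).1)
    fun i => (foldAt_spec hk hr (d i)).2).comp (IsTorusEmbedding.add_right fun i => (r : ZMod k) - x₀ i)

open Classical in
lemma sum_foldTorus {k r h m : ℕ} [NeZero k] (hk : 4 ≤ k) (hr : k = 2 * r) {ι : Type} [Fintype ι]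
    [DecidableEq ι]
    {c : (ι → ZMod k) → ι → ZMod h} (hc₀ : ∀ p, ∑ i, c p i = 0)
    (hc₁ : ∀ q, ∑ i, c (q - (Pi.single i 1 : ι → ZMod k)) i = 1) {H : Set (Fin m → ZMod k)}
    {x₀ : Fin m → ZMod k} (hx₀ : x₀ ∈ H) (v : Fin m × (ι ⊕ ι ⊕ Unit) → ZMod k) :
    (∑ d : Fin m → _, if v ∈ foldTorus r x₀ d '' H then ∏ i, foldWeight c (d i) else 0) = 1 := by
  have h1 : ∀ d : Fin m → ((ι → ZMod k) × ι) × ((ι → ZMod k) × ι) × ZMod k,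
      (if v ∈ foldTorus r x₀ d '' H then ∏ i, foldWeight c (d i) else 0) =
      ∑ x : Fin m → ZMod k, if x ∈ H then
        ∏ i, (if foldAt r (d i) (x i + ((r : ZMod k) - x₀ i)) = fun l => v (i, l) then foldWeight c (d i)
          else 0) else 0 := by
    intro d
    have h2 : ∀ x, (∀ i, foldAt r (d i) (x i + ((r : ZMod k) - x₀ i)) = fun l => v (i, l)) ↔
        foldTorus r x₀ d x = v :=
      fun x => ⟨fun h => funext fun l => congrFun (h l.1) l.2, fun h i => by rw [← h]; rfl⟩
    simp only [Finset.prod_ite_zero, Finset.mem_univ, forall_const, h2]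
    split_ifs with h
    · obtain ⟨x, hx, rfl⟩ := h
      rw [Finset.sum_eq_single x]
      · simp [hx]
      · intro y _ hy
        simp [(foldTorus_isTorusEmbedding hk hr x₀ d).1.eq_iff, hy]
      · simp
    · refine (Finset.sum_eq_zero fun x _ => ?_).symm
      split_ifs with hx hv
      · exact absurd ⟨x, hx, hv⟩ h
      · rfl
      · rfl
  simp only [h1]
  rw [Finset.sum_comm]
  have h3 : ∀ x : Fin m → ZMod k, (∑ d : Fin m → ((ι → ZMod k) × ι) × ((ι → ZMod k) × ι) × ZMod k,
      if x ∈ H then ∏ i, (if foldAt r (d i) (x i + ((r : ZMod k) - x₀ i)) = fun l => v (i, l) then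
        foldWeight c (d i) else 0) else 0) = if x = x₀ then 1 else 0 := by
    intro x
    by_cases hx : x ∈ H
    · simp only [hx, if_true]
      rw [← Fintype.piFinset_univ, ← Finset.prod_univ_sum (fun _ => Finset.univ) fun i d =>
        if foldAt r d (x i + ((r : ZMod k) - x₀ i)) = fun l => v (i, l) then foldWeight c d else 0]
      simp only [sum_foldWeight hk hr hc₀ hc₁, Finset.prod_ite_zero, Finset.prod_const_one]
      refine if_congr ?_ rfl rfl
      rw [funext_iff]
      simp [add_sub_left_comm, sub_eq_zero]
    · have : x ≠ x₀ := fun h => hx (h ▸ hx₀)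
      simp [hx, this]
  simp [h3]

lemma hasPerfectInducedPacking_of_partition {k m n : ℕ} (hk : 4 ≤ k) {H : (torus k m).Subgraph}
    (hind : H.IsInduced) (S : (Fin n → ZMod k) → Set (Fin n → ZMod k)) (hmem : ∀ u, u ∈ S u)
    (heq : ∀ u v, v ∈ S u → S v = S u)
    (himg : ∀ u, ∃ φ : (Fin m → ZMod k) → Fin n → ZMod k, IsTorusEmbedding φ ∧
      S u = φ '' H.verts) :
    HasPerfectInducedPacking (torus k n) H.coe := by
  refine ⟨Set.range fun u => (⊤ : (torus k n).Subgraph).induce (S u), ?_, ?_, ?_⟩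
  · rintro _ ⟨u, rfl⟩
    refine ⟨fun v hv w hw hvw => ⟨hv, hw, hvw⟩, ?_⟩
    obtain ⟨φ, hφ, hS⟩ := himg u
    let e : H.verts ≃ S u := (Equiv.Set.image φ H.verts hφ.1).trans (Equiv.setCongr hS.symm)
    have he : ∀ x, (e x : Fin n → ZMod k) = φ x := fun x => rfl
    refine ⟨⟨e, fun {x y} => ?_⟩⟩
    have h1 : ((⊤ : (torus k n).Subgraph).induce (S u)).Adj (e x) (e y) ↔
        (torus k n).Adj (e x) (e y) :=
      ⟨fun h => h.2.2, fun h => ⟨(e x).2, (e y).2, h⟩⟩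
    have h2 : H.Adj x y ↔ (torus k m).Adj x y := ⟨fun h => h.adj_sub, fun h => hind x.2 y.2 h⟩
    refine Iff.trans h1 (Iff.trans ?_ h2.symm)
    rw [torus_adj_iff hk, torus_adj_iff hk, he, he, hφ.2]
  · rintro _ ⟨u, rfl⟩ _ ⟨v, rfl⟩ huv
    refine Set.disjoint_left.2 fun w hw hw' => huv ?_
    have h1 : S w = S u := heq u w hw
    have h2 : S w = S v := heq v w hw'
    simp only [← h1, ← h2]
  · refine Set.eq_univ_of_forall fun u => Set.mem_biUnion ⟨u, rfl⟩ ?_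
    exact hmem u

lemma LineTileable.hasPerfectInducedPacking {k m n : ℕ} (hk : 4 ≤ k) {H : (torus k m).Subgraph}
    (hind : H.IsInduced) {κ ι : Type} {F : Set (Set (ι → ZMod k))}
    (hF : ∀ B ∈ F, B.Nonempty → ∃ φ : (Fin m → ZMod k) → ι → ZMod k, IsTorusEmbedding φ ∧
      B = φ '' H.verts)
    (hT : LineTileable F (Set.univ : Set (κ → ι → ZMod k))) {e : κ × ι → Fin n}
    (he : Function.Injective e) : HasPerfectInducedPacking (torus k n) H.coe := by
  have : Fact (1 < k) := ⟨by omega⟩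
  obtain ⟨σ, hσ, hσF, huniq, hcov⟩ := hT
  let b : (Fin n → ZMod k) → κ → ι → ZMod k := fun u j s => u (e (j, s))
  choose dir hdir using fun u => (hcov (b u)).1 trivial
  have hdir_eq : ∀ u j, b u j ∈ σ j (b u) → dir u = j := fun u j h => huniq (b u) _ _ (hdir u) h
  let S : (Fin n → ZMod k) → Set (Fin n → ZMod k) := fun u =>
    {v | (∀ l, (∀ s, e (dir u, s) ≠ l) → v l = u l) ∧ b v (dir u) ∈ σ (dir u) (b u)}
  have hσ_eq : ∀ u v, v ∈ S u → σ (dir u) (b v) = σ (dir u) (b u) := by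
    rintro u v ⟨hv, -⟩
    refine hσ _ _ _ fun i hi => funext fun s => hv _ fun s' h => hi ?_
    exact (congrArg Prod.fst (he h)).symm
  have hdir_mem : ∀ u v, v ∈ S u → dir v = dir u := by
    intro u v hv
    refine hdir_eq v _ ?_
    rw [hσ_eq u v hv]
    exact hv.2
  refine hasPerfectInducedPacking_of_partition hk hind S (fun u => ⟨fun _ _ => rfl, hdir u⟩)
    (fun u v hv => ?_) fun u => ?_
  · ext w
    simp only [S, Set.mem_ofPred_eq, hdir_mem u v hv, hσ_eq u v hv]
    refine and_congr_left fun _ => forall_congr' fun l => forall_congr' fun hl => ?_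
    rw [hv.1 l hl]
  · obtain ⟨φ, hφ, hB⟩ := hF _ (hσF (dir u) (b u)) ⟨_, hdir u⟩
    have hg : Function.Injective fun s => e (dir u, s) := fun s s' h =>
      congrArg Prod.snd (he h)
    refine ⟨(fun y => Function.extend (fun s => e (dir u, s)) y u) ∘ φ,
      (IsTorusEmbedding.of_coordinates _ hg (Function.extend (fun s => e (dir u, s)) 0 u)
        (fun y s => ?_) fun y l hl => ?_).comp hφ, ?_⟩
    · rw [hg.extend_apply, hg.extend_apply, Pi.zero_apply, zero_add]
    · rw [Function.extend_apply' _ _ _ (by simpa using hl),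
        Function.extend_apply' _ _ _ (by simpa using hl)]
    · rw [Set.image_comp, ← hB]
      ext v
      constructor
      · rintro ⟨hv, hv'⟩
        refine ⟨_, hv', funext fun l => ?_⟩
        by_cases hl : ∃ s, e (dir u, s) = l
        · obtain ⟨s, rfl⟩ := hl
          exact hg.extend_apply _ _ _
        · dsimp only
          rw [Function.extend_apply' _ _ _ hl, hv l (by simpa using hl)]
      · rintro ⟨y, hy, rfl⟩
        refine ⟨fun l hl => Function.extend_apply' _ _ _ (by simpa using hl), ?_⟩
        convert hy using 1
        exact funext fun s => hg.extend_apply _ _ _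

lemma card_translates {Y : Type} [AddCommGroup Y] (S : Set Y) (v : Y) :
    Nat.card {g // v ∈ (fun u => u + g) '' S} = S.ncard := by
  refine Nat.card_congr ((Equiv.subLeft v).subtypeEquiv fun g => ?_)
  simp [sub_eq_add_neg]

theorem torus_even_perfect_packing (k m : ℕ) (hk : 4 ≤ k) (hke : Even k) (hm : 1 ≤ m)
    (H : (torus k m).Subgraph) (hind : H.IsInduced)
    (hdiv : H.verts.ncard ∣ k ^ m) :
    ∃ n₀ : ℕ, 0 < n₀ ∧ ∀ n, n₀ ≤ n → HasPerfectInducedPacking (torus k n) H.coe := by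
  classical
  obtain ⟨r, hr⟩ := hke
  rw [← two_mul] at hr
  have : NeZero k := ⟨by omega⟩
  have hpos : 0 < H.verts.ncard := Nat.pos_of_dvd_of_pos hdiv (by positivity)
  have : NeZero H.verts.ncard := ⟨hpos.ne'⟩
  obtain ⟨x₀, hx₀⟩ := Set.nonempty_of_ncard_ne_zero hpos.ne'
  obtain ⟨c, hc₀, hc₁⟩ := exists_edge_weights (by omega) hdiv
  obtain ⟨J, _, P, hP, hPcard⟩ := exists_family_of_weights _ _
    fun v => sum_foldTorus (m := m) hk hr hc₀ hc₁ hx₀ v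
  let ι := Fin m × (Option (Fin m) ⊕ Option (Fin m) ⊕ Unit)
  let F : Set (Set (ι → ZMod k)) := insert ∅ {B | ∃ φ : (Fin m → ZMod k) → ι → ZMod k,
    IsTorusEmbedding φ ∧ B = φ '' H.verts}
  let φ : (Fin m → ZMod k) → ι → ZMod k := foldTorus r x₀ fun _ => ((0, none), (0, none), 0)
  have hφ : IsTorusEmbedding φ := foldTorus_isTorusEmbedding hk hr x₀ _
  obtain ⟨κ, _, hκ⟩ := LineTileable.exists_univ hpos (ι → ZMod k) F (Set.mem_insert _ _)
    (fun g => (fun u => u + g) '' (φ '' H.verts))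
    (fun g => Or.inr ⟨_, (IsTorusEmbedding.add_right g).comp hφ, (Set.image_comp _ _ _).symm⟩)
    (fun v => by rw [card_translates, Set.ncard_image_of_injective _ hφ.1]) P
    (fun j => by
      obtain ⟨d, hd⟩ := hP j
      exact Or.inr ⟨_, foldTorus_isTorusEmbedding hk hr x₀ d, hd⟩) hPcard
  obtain ⟨p, ⟨e⟩⟩ := Finite.exists_equiv_fin (κ × ι)
  refine ⟨p + 1, p.succ_pos, fun n hn => ?_⟩
  refine hκ.hasPerfectInducedPacking hk hind (fun B hB hBne => ?_)
    ((Fin.castLE_injective (show p ≤ n by omega)).comp e.injective)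
  rcases hB with rfl | hB
  · exact absurd hBne Set.not_nonempty_empty
  · exact hB
end

section
/- Let k be an odd positive integer that is not a prime power (i.e., k has at least two distinct prime divisors). Then there exist m ≥ 1 and an induced subgraph H of the torus C_k^m such that |V(H)| divides k^m, yet for every n ≥ 1 the torus C_k^n does not admit a perfect H-packing. -/
/-- `G` admits a perfect `H`-packing: pairwise vertex-disjoint subgraphs of `G`,
each isomorphic to `H`, covering all vertices of `G` (copies need not be induced). -/
def HasPerfectPacking {V W : Type*} (G : SimpleGraph V) (H : SimpleGraph W) : Prop :=
  ∃ P : Set G.Subgraph,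
    (∀ K ∈ P, Nonempty (H ≃g K.coe)) ∧
    P.PairwiseDisjoint (fun K => K.verts) ∧
    ⋃ K ∈ P, K.verts = Set.univ

open Finset in
/-- The staircase diagram over `range (N * M)` whose column over `x` has height
`N * g (x / N)`. -/
def staircase (N M : ℕ) (g : ℕ → ℕ) : Finset (Σ _ : ℕ, ℕ) :=
  (range (N * M)).sigma fun x => range (N * g (x / N))

theorem mem_staircase {N M : ℕ} {g : ℕ → ℕ} {x y : ℕ} :
    (⟨x, y⟩ : Σ _ : ℕ, ℕ) ∈ staircase N M g ↔ x < N * M ∧ y < N * g (x / N) := by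
  simp [staircase]

theorem sum_range_mul_residue_mul_div {N : ℕ} [NeZero N] (u : ZMod N → ℕ) (g : ℕ → ℕ) (M : ℕ) :
    ∑ x ∈ Finset.range (N * M), u (x : ZMod N) * g (x / N) =
      (∑ c, u c) * ∑ j ∈ Finset.range M, g j := by
  have hN : 0 < N := Nat.pos_of_ne_zero (NeZero.ne N)
  have hres : ∑ r ∈ Finset.range N, u (r : ZMod N) = ∑ c, u c := by
    refine Finset.sum_bij' (fun r _ => (r : ZMod N)) (fun c _ => c.val) ?_ ?_ ?_ ?_ ?_
    · simp
    · intro c _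
      simpa using ZMod.val_lt c
    · intro r hr
      exact ZMod.val_cast_of_lt (by simpa using hr)
    · intro c _
      simp
    · simp
  induction M with
  | zero => simp
  | succ M ih =>
    rw [Nat.mul_succ, Finset.sum_range_add, ih, Finset.sum_range_succ, mul_add, ← hres,
      Finset.sum_mul _ _ (g M)]
    congr 1
    refine Finset.sum_congr rfl fun r hr => ?_
    rw [Finset.mem_range] at hr
    rw [Nat.mul_add_div hN, Nat.div_eq_of_lt hr]
    simp

theorem card_staircase {N : ℕ} [NeZero N] (M : ℕ) (g : ℕ → ℕ) :
    (staircase N M g).card = N * (N * ∑ j ∈ Finset.range M, g j) := by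
  have h := sum_range_mul_residue_mul_div (N := N) (fun _ => N) g M
  simp only [Finset.sum_const, Finset.card_univ, ZMod.card, smul_eq_mul, mul_assoc] at h
  simp only [staircase, Finset.card_sigma, Finset.card_range, h]

theorem card_range_filter_residue {N : ℕ} [NeZero N] (M : ℕ) (c : ZMod N) :
    ((Finset.range (N * M)).filter fun x : ℕ => (x : ZMod N) = c).card = M := by
  have h := sum_range_mul_residue_mul_div (N := N) (fun r => if r = c then 1 else 0)
    (fun _ => 1) M
  rw [Finset.sum_ite_eq' Finset.univ c] at h
  simpa only [Finset.card_filter, mul_one, Finset.mem_univ, if_true, one_mul, Finset.sum_const,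
    Finset.card_range, smul_eq_mul] using h

theorem card_staircase_filter_residue {N : ℕ} [NeZero N] (M : ℕ) (g : ℕ → ℕ) (c d : ZMod N) :
    ((staircase N M g).filter fun z => (z.1 : ZMod N) = c ∧ (z.2 : ZMod N) = d).card =
      ∑ j ∈ Finset.range M, g j := by
  have h := sum_range_mul_residue_mul_div (N := N) (fun r => if r = c then 1 else 0) g M
  rw [Finset.sum_ite_eq' Finset.univ c] at h
  simp only [Finset.mem_univ, if_true, one_mul] at h
  rw [← h, Finset.card_filter, staircase, Finset.sum_sigma]
  refine Finset.sum_congr rfl fun x _ => ?_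
  by_cases hx : (x : ZMod N) = c
  · simp only [hx, true_and, if_true, one_mul]
    rw [← Finset.card_filter, card_range_filter_residue]
  · simp [hx]

/-- Column heights chosen so that `g 0 = M`, every `g j` with `j < M` is positive, and the
heights sum to `p * M`. -/
def stairHeight (p M j : ℕ) : ℕ := if j = 0 then M else if j < p then p else p - 1

theorem sum_stairHeight {p M : ℕ} (hp : 0 < p) (hpM : p ≤ M) :
    ∑ j ∈ Finset.range M, stairHeight p M j = p * M := by
  obtain ⟨r, rfl⟩ := Nat.exists_eq_add_of_le hpM
  obtain ⟨s, rfl⟩ := Nat.exists_eq_add_one.mpr hp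
  have h1 : ∀ i ∈ Finset.range s, stairHeight (s + 1) (s + 1 + r) (i + 1) = s + 1 := by
    intro i hi
    rw [Finset.mem_range] at hi
    simp [stairHeight]
    omega
  have h2 : ∀ i ∈ Finset.range r,
      stairHeight (s + 1) (s + 1 + r) (s + 1 + i) = s := by
    intro i _
    unfold stairHeight
    split_ifs <;> omega
  rw [Finset.sum_range_add, Finset.sum_congr rfl h2, Finset.sum_range_succ',
    Finset.sum_congr rfl h1]
  simp [stairHeight]
  ring

theorem stairHeight_antitone {p M : ℕ} (hpM : p ≤ M) : Antitone (stairHeight p M) := by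
  intro i j hij
  unfold stairHeight
  split_ifs <;> omega

theorem torus_adj_add_single {k n : ℕ} (h1 : (1 : ZMod k) ≠ 0) (u : Fin n → ZMod k) (i : Fin n) :
    (torus k n).Adj u (u + Pi.single i 1) := by
  rw [torus, SimpleGraph.fromRel_adj]
  refine ⟨fun h => h1 ?_, Or.inr ⟨i, by simp, fun j hj => by simp [hj]⟩⟩
  simpa using congrFun h i

theorem exists_step_of_torus_adj {k n : ℕ} {u v : Fin n → ZMod k} (h : (torus k n).Adj u v) :
    ∃ i, ∃ e : ℤ, (e = 1 ∨ e = -1) ∧ v = u + Pi.single i (e : ZMod k) := by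
  rw [torus, SimpleGraph.fromRel_adj] at h
  obtain ⟨-, ⟨i, hi, hj⟩ | ⟨i, hi, hj⟩⟩ := h
  · refine ⟨i, -1, Or.inr rfl, ?_⟩
    ext j
    by_cases hji : j = i
    · subst hji
      simp [← hi]
    · simp [hji, hj j hji]
  · refine ⟨i, 1, Or.inl rfl, ?_⟩
    ext j
    by_cases hji : j = i
    · subst hji
      simp [← hi]
    · simp [hji, hj j hji]

/-- For odd `k`, a closed walk of length `k` in the torus runs straight along a coordinate axis. -/
theorem closed_walk_straight {k n : ℕ} [NeZero k] (hodd : Odd k) (f : ZMod k → Fin n → ZMod k)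
    (hf : ∀ t, (torus k n).Adj (f t) (f (t + 1))) :
    ∃ i, ∃ e : ℤ, (e = 1 ∨ e = -1) ∧
      ∀ t : ℕ, f t = f 0 + Pi.single i ((e : ZMod k) * t) := by
  choose d s hs hstep using fun t => exists_step_of_torus_adj (hf t)
  let c : Fin n → ZMod k → ℤ := fun i t => if d t = i then s t else 0
  have hc : ∀ i t, -1 ≤ c i t ∧ c i t ≤ 1 := by
    intro i t
    simp only [c]
    rcases hs t with h | h <;> split_ifs <;> omega
  have hdvd : ∀ i, (k : ℤ) ∣ ∑ t, c i t := by
    intro i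
    rw [← ZMod.intCast_zmod_eq_zero_iff_dvd _ k, Int.cast_sum]
    have : ∀ t, ((c i t : ℤ) : ZMod k) = f (t + 1) i - f t i := by
      intro t
      rw [hstep t]
      by_cases h : d t = i
      · subst h
        simp [c]
      · simp [c, h, Ne.symm h]
    simp_rw [this, Finset.sum_sub_distrib]
    rw [sub_eq_zero]
    exact Equiv.sum_comp (Equiv.addRight (1 : ZMod k)) fun t => f t i
  have htotal : ∑ i, ∑ t, c i t = ∑ t, s t := by
    rw [Finset.sum_comm]
    simp [c]
  have hoddsum : Odd (∑ t, s t) := by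
    have : Even (∑ t, (s t - 1)) := by
      refine Finset.even_sum _ fun t _ => ?_
      rcases hs t with h | h <;> rw [h] <;> decide
    rw [Finset.sum_sub_distrib] at this
    simp only [Finset.sum_const, Finset.card_univ, ZMod.card, nsmul_eq_mul, mul_one] at this
    have hk : Odd (k : ℤ) := by exact_mod_cast hodd
    simpa using this.add_odd hk
  obtain ⟨i, hi⟩ : ∃ i, Odd (∑ t, c i t) := by
    by_contra! hne
    rw [← htotal, ← Int.not_even_iff_odd] at hoddsum
    exact hoddsum (Finset.even_sum _ fun i _ => Int.not_odd_iff_even.mp (hne i))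
  have hlarge : (k : ℤ) ≤ |∑ t, c i t| := by
    refine Int.le_of_dvd (abs_pos.mpr fun h => ?_) ((dvd_abs _ _).mpr (hdvd i))
    rw [h] at hi
    exact absurd hi (by decide)
  obtain ⟨e, he, hce⟩ : ∃ e : ℤ, (e = 1 ∨ e = -1) ∧ ∀ t, c i t = e := by
    rcases le_abs.mp hlarge with h | h
    · refine ⟨1, Or.inl rfl, ?_⟩
      have hsum : ∑ t, (1 - c i t) = 0 := by
        refine le_antisymm ?_ (Finset.sum_nonneg fun t _ => by linarith [(hc i t).2])
        rw [Finset.sum_sub_distrib]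
        simp [ZMod.card, h]
      rw [Finset.sum_eq_zero_iff_of_nonneg fun t _ => by linarith [(hc i t).2]] at hsum
      intro t
      linarith [hsum t (Finset.mem_univ t)]
    · refine ⟨-1, Or.inr rfl, ?_⟩
      have hsum : ∑ t, (1 + c i t) = 0 := by
        refine le_antisymm ?_ (Finset.sum_nonneg fun t _ => by linarith [(hc i t).1])
        rw [Finset.sum_add_distrib]
        simp only [Finset.sum_const, Finset.card_univ, ZMod.card, nsmul_eq_mul, mul_one]
        linarith
      rw [Finset.sum_eq_zero_iff_of_nonneg fun t _ => by linarith [(hc i t).1]] at hsum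
      intro t
      linarith [hsum t (Finset.mem_univ t)]
  refine ⟨i, e, he, fun t => ?_⟩
  have hd : ∀ t, d t = i ∧ s t = e := by
    intro t
    have h := hce t
    simp only [c] at h
    split_ifs at h with hdi
    · exact ⟨hdi, h⟩
    · omega
  induction t with
  | zero => simp
  | succ t ih =>
    rw [Nat.cast_succ, hstep, ih, (hd _).1, (hd _).2, add_assoc, ← Pi.single_add, mul_add, mul_one]

/-- Two vertices at distance two in a common coordinate square have only the obvious common
neighbours. -/
theorem eq_of_torus_adj_of_torus_adj {k n : ℕ} {i j : Fin n} (hij : i ≠ j) {a b : ZMod k}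
    (ha : a ≠ 0) (hb : b ≠ 0) {c w : Fin n → ZMod k} (hwc : w ≠ c)
    (h1 : (torus k n).Adj (c + Pi.single i a) w) (h2 : (torus k n).Adj (c + Pi.single j b) w) :
    w = c + Pi.single i a + Pi.single j b := by
  obtain ⟨l, e, -, hl⟩ := exists_step_of_torus_adj h1
  obtain ⟨l', e', -, hl'⟩ := exists_step_of_torus_adj h2
  have hi := congrFun (hl.symm.trans hl') i
  have hj := congrFun (hl.symm.trans hl') j
  by_cases hli : l = i
  · subst hli
    by_cases hl'i : l' = l
    · subst hl'i
      simp [hij.symm] at hj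
      exact absurd hj hb
    · simp [hij, Ne.symm hl'i, add_assoc] at hi
      refine absurd ?_ hwc
      rw [hl, add_assoc, ← Pi.single_add, hi]
      simp
  · by_cases hl'i : l' = i
    · subst hl'i
      simp [hij, Ne.symm hli] at hi
      rw [hl', ← hi, add_right_comm]
    · simp [hij, Ne.symm hli, Ne.symm hl'i] at hi
      exact absurd hi ha

/-- The vertex of `C_k^3` above a cell of a diagram. -/
def cellVertex (k : ℕ) (z : Σ _ : ℕ, ℕ) : Fin 3 → ZMod k := ![(z.1 : ZMod k), (z.2 : ZMod k), 0]

theorem cellVertex_adj_right {k : ℕ} (h1 : (1 : ZMod k) ≠ 0) {x x' : ℕ} (y : ℕ)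
    (hx : (x' : ZMod k) = x + 1) :
    (torus k 3).Adj (cellVertex k ⟨x, y⟩) (cellVertex k ⟨x', y⟩) := by
  convert torus_adj_add_single h1 (cellVertex k ⟨x, y⟩) 0
  ext l
  fin_cases l <;> simp [cellVertex, hx]

theorem cellVertex_adj_up {k : ℕ} (h1 : (1 : ZMod k) ≠ 0) (x : ℕ) {y y' : ℕ}
    (hy : (y' : ZMod k) = y + 1) :
    (torus k 3).Adj (cellVertex k ⟨x, y⟩) (cellVertex k ⟨x, y'⟩) := by
  convert torus_adj_add_single h1 (cellVertex k ⟨x, y⟩) 1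
  ext l
  fin_cases l <;> simp [cellVertex, hy]

theorem natCast_inj_of_lt {k x y : ℕ} (hx : x < k) (hy : y < k) (h : (x : ZMod k) = y) :
    x = y := by
  rw [ZMod.natCast_eq_natCast_iff] at h
  exact h.eq_of_lt_of_lt hx hy

theorem cellVertex_injOn {k : ℕ} {D : Finset (Σ _ : ℕ, ℕ)}
    (hlt : ∀ z ∈ D, z.1 < k ∧ z.2 < k) : Set.InjOn (cellVertex k) D := by
  rintro ⟨x, y⟩ hz ⟨x', y'⟩ hz' h
  have hx := natCast_inj_of_lt (hlt _ hz).1 (hlt _ hz').1 (congrFun h 0)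
  have hy := natCast_inj_of_lt (hlt _ hz).2 (hlt _ hz').2 (congrFun h 1)
  simp_all

/-- An embedding into `C_k^n` of a diagram containing both axes is the restriction of an affine
embedding of `C_k^2`, up to signs and a choice of two coordinates. -/
theorem exists_affine_of_embedding {k n : ℕ} [NeZero k] (hk : 1 < k) (hodd : Odd k)
    {D : Finset (Σ _ : ℕ, ℕ)} (hlt : ∀ z ∈ D, z.1 < k ∧ z.2 < k)
    (hrow : ∀ x < k, ⟨x, 0⟩ ∈ D) (hcol : ∀ y < k, ⟨0, y⟩ ∈ D)
    (hdown : ∀ {x y x' y' : ℕ}, x' ≤ x → y' ≤ y → ⟨x, y⟩ ∈ D → ⟨x', y'⟩ ∈ D)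
    (F : (Σ _ : ℕ, ℕ) → Fin n → ZMod k) (hinj : Set.InjOn F D)
    (hadj : ∀ z ∈ D, ∀ z' ∈ D, (torus k 3).Adj (cellVertex k z) (cellVertex k z') →
      (torus k n).Adj (F z) (F z')) :
    ∃ (b : Fin n → ZMod k) (i j : Fin n) (e d : ℤ), i ≠ j ∧ (e = 1 ∨ e = -1) ∧ (d = 1 ∨ d = -1) ∧
      ∀ x y : ℕ, ⟨x, y⟩ ∈ D →
        F ⟨x, y⟩ = b + Pi.single i ((e : ZMod k) * x) + Pi.single j ((d : ZMod k) * y) := by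
  have h1 : (1 : ZMod k) ≠ 0 := by
    have : Fact (1 < k) := ⟨hk⟩
    exact one_ne_zero
  have hunit : ∀ e : ℤ, e = 1 ∨ e = -1 → (e : ZMod k) ≠ 0 := by
    rintro e (rfl | rfl) <;> simpa using h1
  obtain ⟨i, e, he, hx⟩ := closed_walk_straight hodd (fun t : ZMod k => F ⟨t.val, 0⟩) fun t =>
    hadj _ (hrow _ (ZMod.val_lt _)) _ (hrow _ (ZMod.val_lt _))
      (cellVertex_adj_right h1 0 (by simp))
  obtain ⟨j, d, hd, hy⟩ := closed_walk_straight hodd (fun t : ZMod k => F ⟨0, t.val⟩) fun t =>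
    hadj _ (hcol _ (ZMod.val_lt _)) _ (hcol _ (ZMod.val_lt _))
      (cellVertex_adj_up h1 0 (by simp))
  replace hx : ∀ x < k, F ⟨x, 0⟩ = F ⟨0, 0⟩ + Pi.single i ((e : ZMod k) * x) := by
    intro x hxk
    simpa [ZMod.val_cast_of_lt hxk] using hx x
  replace hy : ∀ y < k, F ⟨0, y⟩ = F ⟨0, 0⟩ + Pi.single j ((d : ZMod k) * y) := by
    intro y hyk
    simpa [ZMod.val_cast_of_lt hyk] using hy y
  have hij : i ≠ j := by
    rintro rfl
    obtain ⟨y, hyk, hde⟩ : ∃ y < k, (d : ZMod k) * y = e := by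
      by_cases hed : d = e
      · exact ⟨1, hk, by simp [hed]⟩
      · refine ⟨k - 1, by omega, ?_⟩
        have : e = -d := by omega
        rw [Nat.cast_sub hk.le, this]
        simp
    have h := hinj (hcol y hyk) (hrow 1 hk) (by rw [hx 1 hk, hy y hyk, hde]; simp)
    simp at h
  refine ⟨F ⟨0, 0⟩, i, j, e, d, hij, he, hd, fun x => ?_⟩
  induction x with
  | zero =>
    intro y hz
    simpa using hy y (hlt _ hz).2
  | succ x ihx =>
    intro y
    induction y with
    | zero =>
      intro hz
      simpa using hx _ (hlt _ hz).1
    | succ y ihy =>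
      intro hz
      have hz0 : ⟨x, y⟩ ∈ D := hdown x.le_succ y.le_succ hz
      have hzr : ⟨x + 1, y⟩ ∈ D := hdown le_rfl y.le_succ hz
      have hzu : ⟨x, y + 1⟩ ∈ D := hdown x.le_succ le_rfl hz
      have hr : F ⟨x + 1, y⟩ = F ⟨x, y⟩ + Pi.single i (e : ZMod k) := by
        rw [ihy hzr, ihx y hz0, Nat.cast_succ, mul_add, mul_one, Pi.single_add]
        abel
      have hu : F ⟨x, y + 1⟩ = F ⟨x, y⟩ + Pi.single j (d : ZMod k) := by
        rw [ihx _ hzu, ihx y hz0, Nat.cast_succ, mul_add, mul_one, Pi.single_add]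
        abel
      have hne : F ⟨x + 1, y + 1⟩ ≠ F ⟨x, y⟩ := by
        intro h
        have := hinj hz hz0 h
        simp at this
      have h := eq_of_torus_adj_of_torus_adj hij (hunit e he) (hunit d hd) hne
        (hr ▸ hadj _ hzr _ hz (cellVertex_adj_up h1 _ (by simp)))
        (hu ▸ hadj _ hzu _ hz (cellVertex_adj_right h1 _ (by simp)))
      rw [h, ihx y hz0]
      push_cast
      simp only [mul_add, mul_one, Pi.single_add]
      abel

/-- An affine copy of a staircase meets the sublattice of vectors vanishing modulo `N` either not
at all or in `∑ g` points. -/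
theorem sum_dvd_card_affine_staircase_filter {k n N M : ℕ} [NeZero N] (hN : N ∣ k) (g : ℕ → ℕ)
    (F : (Σ _ : ℕ, ℕ) → Fin n → ZMod k) {b : Fin n → ZMod k} {i j : Fin n} {e d : ℤ}
    (hij : i ≠ j) (he : e = 1 ∨ e = -1) (hd : d = 1 ∨ d = -1)
    (hF : ∀ x y : ℕ, ⟨x, y⟩ ∈ staircase N M g →
      F ⟨x, y⟩ = b + Pi.single i ((e : ZMod k) * x) + Pi.single j ((d : ZMod k) * y)) :
    ∑ l ∈ Finset.range M, g l ∣
      ((staircase N M g).filter fun z => ∀ l, ZMod.castHom hN (ZMod N) (F z l) = 0).card := by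
  set φ := ZMod.castHom hN (ZMod N)
  have hsolve : ∀ e : ℤ, e = 1 ∨ e = -1 → ∀ u v : ZMod N,
      u + (e : ZMod N) * v = 0 ↔ v = -(e : ZMod N) * u := by
    rintro e (rfl | rfl) u v
    · simp [add_eq_zero_iff_eq_neg']
    · simp [add_neg_eq_zero, eq_comm]
  by_cases hb : ∀ l, l ≠ i → l ≠ j → φ (b l) = 0
  · rw [← card_staircase_filter_residue M g (-(e : ZMod N) * φ (b i)) (-(d : ZMod N) * φ (b j))]
    refine dvd_of_eq (congrArg Finset.card (Finset.filter_congr ?_))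
    rintro ⟨x, y⟩ hz
    rw [hF x y hz, ← hsolve e he, ← hsolve d hd]
    constructor
    · rintro ⟨h1, h2⟩ l
      by_cases hli : l = i
      · subst hli
        simpa [hij] using h1
      · by_cases hlj : l = j
        · subst hlj
          simpa [hli] using h2
        · simpa [hli, hlj] using hb l hli hlj
    · intro h
      exact ⟨by simpa [hij] using h i, by simpa [hij.symm] using h j⟩
  · push Not at hb
    obtain ⟨l, hli, hlj, hl⟩ := hb
    refine ⟨0, ?_⟩
    rw [mul_zero, Finset.card_eq_zero, Finset.filter_eq_empty_iff]
    rintro ⟨x, y⟩ hz h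
    have := h l
    rw [hF x y hz] at this
    simp [hli, hlj] at this
    exact hl this

theorem card_castHom_eq_zero {n N M : ℕ} [NeZero N] [NeZero (N * M)] :
    (Finset.univ.filter fun v : Fin n → ZMod (N * M) =>
      ∀ l, ZMod.castHom (Dvd.intro M rfl : N ∣ N * M) (ZMod N) (v l) = 0).card = M ^ n := by
  have hone : (Finset.univ.filter fun t : ZMod (N * M) =>
      ZMod.castHom (Dvd.intro M rfl : N ∣ N * M) (ZMod N) t = 0).card = M := by
    refine Eq.trans ?_ (card_range_filter_residue M (0 : ZMod N))
    refine Finset.card_bij' (fun t _ => t.val) (fun x _ => (x : ZMod (N * M))) ?_ ?_ ?_ ?_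
    · intro t ht
      simp only [Finset.mem_filter, Finset.mem_univ, true_and] at ht
      rw [← ZMod.natCast_zmod_val t, map_natCast] at ht
      simpa [ZMod.val_lt t] using ht
    · intro x hx
      rw [Finset.mem_filter, map_natCast]
      exact ⟨Finset.mem_univ _, (Finset.mem_filter.mp hx).2⟩
    · simp
    · intro x hx
      exact ZMod.val_cast_of_lt (Finset.mem_range.mp (Finset.mem_filter.mp hx).1)
  have hpi := Fintype.card_piFinset_const (Finset.univ.filter fun t : ZMod (N * M) =>
      ZMod.castHom (Dvd.intro M rfl : N ∣ N * M) (ZMod N) t = 0) n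
  rw [hone] at hpi
  rw [← hpi]
  congr 1
  ext v
  simp only [Finset.mem_filter, Finset.mem_univ, true_and, Fintype.mem_piFinset]

/-- If every member of a perfect packing meets `A` in a multiple of `p` points, then `p` divides
the size of `A`. -/
theorem HasPerfectPacking.dvd_card {V W : Type*} [Fintype V] {G : SimpleGraph V}
    {H : SimpleGraph W} (h : HasPerfectPacking G H) (A : Finset V) (p : ℕ)
    (hA : ∀ K : G.Subgraph, Nonempty (H ≃g K.coe) → p ∣ ((A : Set V) ∩ K.verts).ncard) :
    p ∣ A.card := by
  classical
  obtain ⟨P, hP, hdisj, hcover⟩ := h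
  have hAeq : A = (Set.toFinite P).toFinset.biUnion fun K => A.filter fun v => v ∈ K.verts := by
    ext v
    have hv : v ∈ ⋃ K ∈ P, K.verts := hcover ▸ Set.mem_univ v
    simp only [Set.mem_iUnion] at hv
    obtain ⟨K, hK, hvK⟩ := hv
    simp only [Finset.mem_biUnion, Set.Finite.mem_toFinset, Finset.mem_filter]
    exact ⟨fun hvA => ⟨K, hK, hvA, hvK⟩, fun ⟨_, _, hvA, _⟩ => hvA⟩
  rw [hAeq, Finset.card_biUnion]
  · refine Finset.dvd_sum fun K hK => ?_
    refine (hA K (hP K (by simpa using hK))).trans (dvd_of_eq ?_)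
    rw [← Set.ncard_coe_finset]
    congr 1
    ext v
    simp
  · intro K hK K' hK' hne
    rw [Function.onFun, Finset.disjoint_left]
    intro v hv hv'
    exact Set.disjoint_left.mp (hdisj (by simpa using hK) (by simpa using hK') hne)
      (Finset.mem_filter.mp hv).2 (Finset.mem_filter.mp hv').2

/-- The subgraph of `C_k^3` induced by the cells of a diagram. -/
def cellGraph (k : ℕ) (D : Finset (Σ _ : ℕ, ℕ)) : (torus k 3).Subgraph :=
  (⊤ : (torus k 3).Subgraph).induce (cellVertex k '' D)

theorem exists_embedding_of_iso {k : ℕ} {D : Finset (Σ _ : ℕ, ℕ)}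
    (hlt : ∀ z ∈ D, z.1 < k ∧ z.2 < k) {V : Type*} [Nonempty V] {G : SimpleGraph V}
    {K : G.Subgraph} (φ : (cellGraph k D).coe ≃g K.coe) :
    ∃ F : (Σ _ : ℕ, ℕ) → V, Set.InjOn F D ∧ F '' D = K.verts ∧
      ∀ z ∈ D, ∀ z' ∈ D, (torus k 3).Adj (cellVertex k z) (cellVertex k z') →
        G.Adj (F z) (F z') := by
  classical
  have hmem : ∀ {z}, z ∈ D → cellVertex k z ∈ (cellGraph k D).verts :=
    fun hz => ⟨_, hz, rfl⟩
  let F : (Σ _ : ℕ, ℕ) → V := fun z =>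
    if hz : z ∈ D then (φ ⟨cellVertex k z, hmem hz⟩ : V) else Classical.arbitrary V
  have hF : ∀ z (hz : z ∈ D), F z = φ ⟨cellVertex k z, hmem hz⟩ := fun z hz => dif_pos hz
  refine ⟨F, ?_, ?_, ?_⟩
  · intro z hz z' hz' h
    rw [hF z hz, hF z' hz'] at h
    have h' := φ.injective (Subtype.ext h)
    exact cellVertex_injOn hlt hz hz' (congrArg Subtype.val h')
  · ext v
    constructor
    · rintro ⟨z, hz, rfl⟩
      rw [hF z hz]
      exact Subtype.property _
    · intro hv
      obtain ⟨⟨_, z, hz, rfl⟩, hzv⟩ := φ.surjective ⟨v, hv⟩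
      exact ⟨z, hz, by rw [hF z hz, hzv]⟩
  · intro z hz z' hz' h
    rw [hF z hz, hF z' hz']
    refine K.coe_adj_sub _ _ (φ.map_rel_iff.mpr ?_)
    exact ⟨hmem hz, hmem hz', h⟩

theorem torus_odd_not_prime_power_unpackable (k : ℕ) (hk : 0 < k) (hodd : Odd k)
    (hnpp : ∃ p q : ℕ, p.Prime ∧ q.Prime ∧ p ≠ q ∧ p ∣ k ∧ q ∣ k) :
    ∃ m : ℕ, 1 ≤ m ∧ ∃ H : (torus k m).Subgraph, H.IsInduced ∧
      H.verts.ncard ∣ k ^ m ∧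
      ∀ n : ℕ, 1 ≤ n → ¬ HasPerfectPacking (torus k n) H.coe := by
  obtain ⟨p, q, hp, hq, hpq, hpk, hqk⟩ :
      ∃ p q : ℕ, p.Prime ∧ q.Prime ∧ p < q ∧ p ∣ k ∧ q ∣ k := by
    obtain ⟨p, q, hp, hq, hne, hpk, hqk⟩ := hnpp
    rcases hne.lt_or_gt with h | h
    · exact ⟨p, q, hp, hq, h, hpk, hqk⟩
    · exact ⟨q, p, hq, hp, h, hqk, hpk⟩
  obtain ⟨a, M, hpM, rfl⟩ := Nat.exists_eq_pow_mul_and_not_dvd hk.ne' p hp.ne_one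
  set N := p ^ a with hNdef
  have : NeZero N := ⟨(pow_pos hp.pos a).ne'⟩
  have : NeZero (N * M) := ⟨hk.ne'⟩
  have hN : 0 < N := pow_pos hp.pos a
  have hM : 0 < M := Nat.pos_of_mul_pos_left hk
  have hpN : p ∣ N := (hp.dvd_mul.mp hpk).resolve_right hpM
  have hqM : q ∣ M := (hq.dvd_mul.mp hqk).resolve_left fun h =>
    hpq.ne' ((Nat.prime_dvd_prime_iff_eq hq hp).mp (hq.dvd_of_dvd_pow h))
  have hpleM : p ≤ M := hpq.le.trans (Nat.le_of_dvd hM hqM)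
  have hk1 : 1 < N * M := hp.one_lt.trans_le (Nat.le_of_dvd hk hpk)
  have hanti := stairHeight_antitone hpleM
  have hzero : stairHeight p M 0 = M := rfl
  have hpos : ∀ j, 0 < stairHeight p M j := by
    intro j
    have := hp.two_le
    unfold stairHeight
    split_ifs <;> omega
  set D := staircase N M (stairHeight p M) with hD
  have hlt : ∀ z ∈ D, z.1 < N * M ∧ z.2 < N * M := by
    rintro ⟨x, y⟩ hz
    rw [hD, mem_staircase] at hz
    exact ⟨hz.1, hz.2.trans_le (Nat.mul_le_mul_left N (hanti (Nat.zero_le _)))⟩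
  refine ⟨3, by norm_num, cellGraph (N * M) D, ?_, ?_, ?_⟩
  · intro u hu v hv h
    exact ⟨hu, hv, h⟩
  · rw [show (cellGraph (N * M) D).verts = cellVertex (N * M) '' D from rfl,
      (cellVertex_injOn hlt).ncard_image, Set.ncard_coe_finset, hD, card_staircase,
      sum_stairHeight hp.pos hpleM]
    obtain ⟨c, hc⟩ := hpN
    exact ⟨c * M ^ 2, by rw [hc]; ring⟩
  · intro n _ hpack
    refine hpM (hp.dvd_of_dvd_pow (n := n) ?_)
    rw [← card_castHom_eq_zero (n := n) (N := N) (M := M)]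
    refine hpack.dvd_card _ p fun K ⟨φ⟩ => ?_
    obtain ⟨F, hinj, himage, hadj⟩ := exists_embedding_of_iso hlt φ
    obtain ⟨b, i, j, e, d, hij, he, hd, haff⟩ := exists_affine_of_embedding hk1 hodd hlt
      (fun x hx => mem_staircase.mpr ⟨hx, Nat.mul_pos hN (hpos _)⟩)
      (fun y hy => mem_staircase.mpr ⟨hk, by simpa [hzero] using hy⟩)
      (fun {x y x' y'} hx hy hz => by
        rw [hD, mem_staircase] at hz ⊢
        exact ⟨hx.trans_lt hz.1, hy.trans_lt (hz.2.trans_le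
          (Nat.mul_le_mul_left N (hanti (Nat.div_le_div_right hx))))⟩)
      F hinj hadj
    have hdvd := sum_dvd_card_affine_staircase_filter (Dvd.intro M rfl) _ F hij he hd haff
    rw [sum_stairHeight hp.pos hpleM] at hdvd
    refine ((Dvd.intro M rfl).trans hdvd).trans (dvd_of_eq ?_)
    rw [← Set.ncard_coe_finset, ← Set.InjOn.ncard_image (f := F)
      (hinj.mono (by exact_mod_cast Finset.filter_subset _ _)), ← himage]
    congr 1
    ext v
    constructor
    · rintro ⟨z, hz, rfl⟩
      rw [Finset.mem_coe, Finset.mem_filter] at hz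
      exact ⟨Finset.mem_coe.mpr (Finset.mem_filter.mpr ⟨Finset.mem_univ _, hz.2⟩), z, hz.1, rfl⟩
    · rintro ⟨hv, z, hz, rfl⟩
      exact ⟨z, Finset.mem_coe.mpr (Finset.mem_filter.mpr
        ⟨hz, (Finset.mem_filter.mp (Finset.mem_coe.mp hv)).2⟩), rfl⟩
end

section
/- For every integer k ≥ 5, there exists a subgraph H of the hypercube Q_k containing a subgraph isomorphic to Q_{k-1}, such that for no n ≥ 1 can the edge set of Q_n be partitioned into the edge sets of pairwise edge-disjoint subgraphs of Q_n each isomorphic to H (the copies of H are not required to be induced). -/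
/-- The hypercube `Q_n`: vertices are functions `Fin n → ZMod 2`, adjacent iff they
differ in exactly one coordinate. -/
def cube (n : ℕ) : SimpleGraph (Fin n → ZMod 2) :=
  SimpleGraph.fromRel fun u v => ∃ i, u i ≠ v i ∧ ∀ j, j ≠ i → u j = v j

/-- The edge set of `G` can be partitioned into the edge sets of pairwise edge-disjoint
subgraphs of `G`, each isomorphic to `H` (copies need not be induced). -/
def HasPerfectEdgePacking {V W : Type*} (G : SimpleGraph V) (H : SimpleGraph W) : Prop :=
  ∃ P : Set G.Subgraph,
    (∀ K ∈ P, Nonempty (H ≃g K.coe)) ∧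
    P.PairwiseDisjoint (fun K => K.edgeSet) ∧
    ⋃ K ∈ P, K.edgeSet = G.edgeSet

theorem cube_adj {n : ℕ} {u v : Fin n → ZMod 2} :
    (cube n).Adj u v ↔ ∃ i, v = u + Pi.single i 1 := by
  have key : ∀ a b : ZMod 2, a ≠ b → b = a + 1 := by decide
  simp only [cube, SimpleGraph.fromRel_adj]
  constructor
  · rintro ⟨-, ⟨i, hi, h⟩ | ⟨i, hi, h⟩⟩ <;> refine ⟨i, funext fun j => ?_⟩ <;>
      by_cases hj : j = i
    · subst hj; simpa using key _ _ hi
    · simp [hj, h j hj]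
    · subst hj; simpa using key _ _ hi.symm
    · simp [hj, h j hj]
  · rintro ⟨i, rfl⟩
    refine ⟨fun h => ?_, Or.inl ⟨i, by simp, fun j hj => by simp [hj]⟩⟩
    simpa using congrFun h i

theorem cube_single_injective {n : ℕ} {i j : Fin n}
    (h : (Pi.single i 1 : Fin n → ZMod 2) = Pi.single j 1) : i = j := by
  by_contra hij
  simpa [Pi.single_apply, hij] using congrFun h i

/-- Opposite edges of a 4-cycle in a hypercube have the same direction. -/
theorem cube_four_cycle_direction {n : ℕ} {a b c d : Fin n → ZMod 2} {p q r s : Fin n}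
    (hab : b = a + Pi.single p 1) (hbc : c = b + Pi.single q 1)
    (hcd : c = d + Pi.single r 1) (hda : d = a + Pi.single s 1)
    (hac : a ≠ c) (hbd : b ≠ d) : r = p := by
  have two : ∀ x : ZMod 2, x + x = 0 := by decide
  have hpq : p ≠ q := by
    rintro rfl
    apply hac
    rw [hbc, hab]
    funext j
    simp [add_assoc, two]
  have hps : s ≠ p := by
    rintro rfl
    exact hbd (hab.trans hda.symm)
  by_contra hrp
  have e : a + Pi.single p 1 + Pi.single q 1 = a + Pi.single s 1 + Pi.single r 1 := by
    rw [← hab, ← hbc, hcd, hda]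
  have := congrFun e p
  simp [hpq, hps.symm, Ne.symm hrp] at this

/-- An injective adjacency-preserving map from a hypercube without its origin to a hypercube
sends parallel edges to parallel edges. -/
theorem punctured_cube_map_direction {k n : ℕ} {g : (Fin k → ZMod 2) → Fin n → ZMod 2}
    (hinj : ∀ x y, x ≠ 0 → y ≠ 0 → g x = g y → x = y)
    (hadj : ∀ x y, x ≠ 0 → y ≠ 0 → (cube k).Adj x y → (cube n).Adj (g x) (g y))
    {j : Fin k} {p : Fin n} (hp : g (1 + Pi.single j 1) = g 1 + Pi.single p 1)
    (x : Fin k → ZMod 2) (hx : ∃ l, l ≠ j ∧ x l ≠ 0) :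
    g (x + Pi.single j 1) = g x + Pi.single p 1 := by
  have two : ∀ x : ZMod 2, x + x = 0 := by decide
  have one : ∀ x : ZMod 2, x ≠ 0 → x = 1 := by decide
  have twov : ∀ (m : ℕ) (y : Fin m → ZMod 2) (i : Fin m),
      y + Pi.single i 1 + Pi.single i 1 = y := fun m y i => by
    funext t; simp [add_assoc, two]
  induction hN : (Finset.univ.filter fun l => x l = 0).card using Nat.strong_induction_on
    generalizing x with
  | _ N ih =>
    by_cases hz : ∃ l, x l = 0
    · obtain ⟨l, hl⟩ := hz
      have hlt : (Finset.univ.filter fun t => (x + Pi.single l 1 : Fin k → ZMod 2) t = 0).card < N := by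
        rw [← hN]
        apply Finset.card_lt_card
        refine Finset.ssubset_iff_of_subset ?_ |>.2 ⟨l, by simp [hl], by simp [hl]⟩
        intro t
        by_cases ht : t = l
        · subst ht; simp [hl]
        · simp [ht]
      obtain ⟨w, hwj, hw⟩ := hx
      have hwl : w ≠ l := by rintro rfl; exact hw hl
      have hxl := ih _ hlt (x + Pi.single l 1) ⟨w, hwj, by simpa [hwl] using hw⟩ rfl
      by_cases hlj : l = j
      · subst hlj
        rw [twov] at hxl
        rw [hxl, twov]
      · have n1 : x ≠ 0 := fun h => hw (by simp [h])
        have n2 : x + Pi.single j 1 ≠ 0 := fun h => hw (by simpa [hwj] using congrFun h w)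
        have n3 : x + Pi.single l 1 ≠ 0 := fun h => hw (by simpa [hwl] using congrFun h w)
        have n4 : x + Pi.single l 1 + Pi.single j 1 ≠ 0 := fun h =>
          hw (by simpa [hwl, hwj] using congrFun h w)
        obtain ⟨s, hs⟩ := cube_adj.1 (hadj _ _ n1 n3 (cube_adj.2 ⟨l, rfl⟩))
        obtain ⟨r, hr⟩ := cube_adj.1 (hadj _ _ n1 n2 (cube_adj.2 ⟨j, rfl⟩))
        obtain ⟨q, hq⟩ := cube_adj.1 (hadj _ _ n2 n4 (cube_adj.2 ⟨l, add_right_comm _ _ _⟩))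
        have := cube_four_cycle_direction hr hq hxl hs
          (fun h => by
            have := congrFun (hinj _ _ n1 n4 h) j
            simp [Ne.symm hlj] at this)
          (fun h => by
            have := congrFun (hinj _ _ n2 n3 h) j
            simp [Ne.symm hlj] at this)
        rw [hr, this]
    · push Not at hz
      rw [show x = 1 from funext fun l => one _ (hz l)]
      exact hp

/-- The hypercube without its origin, as an induced subgraph. -/
def puncturedCube (k : ℕ) : (cube k).Subgraph :=
  (⊤ : (cube k).Subgraph).induce {0}ᶜ

open Classical in
/-- In a copy of a punctured hypercube, the number of edges in each direction, counted with both
orientations, is divisible by `2 ^ k - 2`. -/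
theorem dvd_card_direction {k n : ℕ} (hk : 2 ≤ k) {K : (cube n).Subgraph}
    (φ : (puncturedCube k).coe ≃g K.coe) (i : Fin n) :
    2 ^ k - 2 ∣ (Finset.univ.filter fun u => K.Adj u (u + Pi.single i 1)).card := by
  have mem : ∀ x, x ∈ (puncturedCube k).verts ↔ x ≠ 0 := fun x => by simp [puncturedCube]
  have hA : ∀ x y, (puncturedCube k).Adj x y ↔ x ≠ 0 ∧ y ≠ 0 ∧ (cube k).Adj x y :=
    fun x y => by simp [puncturedCube]
  let g : (Fin k → ZMod 2) → Fin n → ZMod 2 := fun x =>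
    if h : x ∈ (puncturedCube k).verts then (φ ⟨x, h⟩).1 else 0
  have hg : ∀ x (h : x ∈ (puncturedCube k).verts), g x = (φ ⟨x, h⟩).1 := fun x h => dif_pos h
  have hinj : ∀ x y, x ≠ 0 → y ≠ 0 → g x = g y → x = y := fun x y hx hy h => by
    rw [hg x ((mem x).2 hx), hg y ((mem y).2 hy)] at h
    exact congrArg Subtype.val (φ.injective (Subtype.ext h))
  have hK : ∀ x y, x ≠ 0 → y ≠ 0 → ((cube k).Adj x y ↔ K.Adj (g x) (g y)) :=
    fun x y hx hy => by
      rw [hg x ((mem x).2 hx), hg y ((mem y).2 hy), ← SimpleGraph.Subgraph.coe_adj,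
        φ.map_adj_iff, SimpleGraph.Subgraph.coe_adj, hA]
      simp [hx, hy]
  have hsurj : ∀ u ∈ K.verts, ∃ x, x ≠ 0 ∧ g x = u := fun u hu => by
    obtain ⟨⟨x, hx⟩, h⟩ := φ.surjective ⟨u, hu⟩
    exact ⟨x, (mem x).1 hx, by rw [hg x hx, h]⟩
  have hadj : ∀ x y, x ≠ 0 → y ≠ 0 → (cube k).Adj x y → (cube n).Adj (g x) (g y) :=
    fun x y hx hy h => ((hK x y hx hy).1 h).adj_sub
  let D : Fin k → Finset (Fin k → ZMod 2) := fun j =>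
    Finset.univ.filter fun x => x ≠ 0 ∧ x + Pi.single j 1 ≠ 0
  let F : Fin k → Finset (Fin k → ZMod 2) := fun j =>
    (D j).filter fun x => g (x + Pi.single j 1) = g x + Pi.single i 1
  have two : ∀ x : ZMod 2, x + x = 0 := by decide
  have neg : ∀ x : ZMod 2, -x = x := by decide
  have hD : ∀ j, (D j).card = 2 ^ k - 2 := fun j => by
    have : D j = ({0, Pi.single j 1} : Finset _)ᶜ := by
      ext x
      have : x + Pi.single j 1 = 0 ↔ x = Pi.single j 1 := by
        rw [add_eq_zero_iff_eq_neg]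
        rw [show -(Pi.single j 1 : Fin k → ZMod 2) = Pi.single j 1 from funext fun _ => neg _]
      simp [D, this]
    rw [this, Finset.card_compl, Finset.card_pair]
    · simp
    · intro h
      simpa using congrFun h j
  have hcard : (Finset.univ.filter fun u => K.Adj u (u + Pi.single i 1)).card =
      ∑ j, (F j).card := by
    rw [← Finset.card_sigma]
    symm
    refine Finset.card_bij (fun a _ => g a.2) ?_ ?_ ?_
    · rintro ⟨j, x⟩ h
      simp only [Finset.mem_sigma, Finset.mem_univ, true_and, F, D, Finset.mem_filter] at h ⊢
      rw [← h.2]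
      exact (hK _ _ h.1.1 h.1.2).1 (cube_adj.2 ⟨j, rfl⟩)
    · rintro ⟨j, x⟩ h ⟨j', x'⟩ h' e
      simp only [Finset.mem_sigma, Finset.mem_univ, true_and, F, D, Finset.mem_filter] at h h' e
      obtain rfl := hinj _ _ h.1.1 h'.1.1 e
      have := add_left_cancel (hinj _ _ h.1.2 h'.1.2 (h.2.trans h'.2.symm))
      rw [cube_single_injective this]
    · intro u hu
      simp only [Finset.mem_filter, Finset.mem_univ, true_and] at hu
      obtain ⟨x, hx, rfl⟩ := hsurj u hu.fst_mem
      obtain ⟨y, hy, e⟩ := hsurj _ hu.snd_mem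
      rw [← e] at hu
      obtain ⟨j, rfl⟩ := cube_adj.1 ((hK x y hx hy).2 hu)
      exact ⟨⟨j, x⟩, by simp [F, D, hx, hy, e], rfl⟩
  rw [hcard]
  refine Finset.dvd_sum fun j _ => ?_
  have : Nontrivial (Fin k) := Fin.nontrivial_iff_two_le.2 hk
  obtain ⟨w, hw⟩ := exists_ne j
  have h1 : (1 : Fin k → ZMod 2) ≠ 0 := fun h => by simpa using congrFun h w
  have h2 : (1 + Pi.single j 1 : Fin k → ZMod 2) ≠ 0 := fun h => by
    simpa [hw] using congrFun h w
  obtain ⟨p, hp⟩ := cube_adj.1 (hadj _ _ h1 h2 (cube_adj.2 ⟨j, rfl⟩))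
  have hdir : ∀ x ∈ D j, g (x + Pi.single j 1) = g x + Pi.single p 1 := by
    intro x hx
    simp only [D, Finset.mem_filter, Finset.mem_univ, true_and] at hx
    refine punctured_cube_map_direction hinj hadj hp x ?_
    by_contra! hc
    have hz : ∀ y : ZMod 2, y = 0 ∨ y = 1 := by decide
    rcases hz (x j) with h | h
    · exact hx.1 (funext fun l => if e : l = j then e ▸ h else hc l e)
    · refine hx.2 (funext fun l => ?_)
      by_cases e : l = j
      · subst e; simp [h, two]
      · simp [e, hc l e]
  by_cases hpi : p = i
  · have : F j = D j := Finset.filter_true_of_mem fun x hx => hpi ▸ hdir x hx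
    rw [this, hD]
  · have : F j = ∅ := Finset.filter_false_of_mem fun x hx h =>
      hpi (cube_single_injective (add_left_cancel ((hdir x hx).symm.trans h)))
    simp [this]

theorem two_pow_sub_two_not_dvd {k : ℕ} (hk : 3 ≤ k) (n : ℕ) : ¬ 2 ^ k - 2 ∣ 2 ^ n := by
  intro h
  obtain ⟨m, rfl⟩ : ∃ m, k = m + 3 := ⟨k - 3, by omega⟩
  have e : 2 ^ (m + 3) - 2 = 2 * (2 ^ (m + 2) - 1) := by rw [pow_succ]; omega
  have hd : 2 ^ (m + 2) - 1 ∣ 2 ^ n := (Dvd.intro_left 2 e.symm).trans h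
  have pos : 1 ≤ 2 ^ m := Nat.one_le_two_pow
  have hc : Nat.Coprime (2 ^ (m + 2) - 1) (2 ^ n) := by
    refine Nat.Coprime.pow_right _ (Nat.coprime_two_right.2 ?_)
    rw [Nat.odd_iff, pow_add]
    omega
  have := hc.eq_one_of_dvd hd
  rw [pow_add] at this
  omega

theorem puncturedCube_not_hasPerfectEdgePacking {k n : ℕ} (hk : 3 ≤ k) (hn : 1 ≤ n) :
    ¬ HasPerfectEdgePacking (cube n) (puncturedCube k).coe := by
  classical
  rintro ⟨P, hP, hdisj, hcover⟩
  let i : Fin n := ⟨0, hn⟩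
  let S : (cube n).Subgraph → Finset (Fin n → ZMod 2) := fun K =>
    Finset.univ.filter fun u => K.Adj u (u + Pi.single i 1)
  have hfin : P.Finite := Set.toFinite P
  have hS : (Finset.univ : Finset (Fin n → ZMod 2)) = hfin.toFinset.biUnion S := by
    ext u
    have hu : s(u, u + Pi.single i 1) ∈ (cube n).edgeSet := cube_adj.2 ⟨i, rfl⟩
    rw [← hcover] at hu
    simpa [S] using hu
  have hcard : 2 ^ n = ∑ K ∈ hfin.toFinset, (S K).card := by
    rw [← Finset.card_biUnion, ← hS]
    · simp
    · intro K hK L hL hKL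
      refine Finset.disjoint_left.2 ?_
      intro u hu hu'
      simp only [S, Finset.mem_filter, Finset.mem_univ, true_and] at hu hu'
      exact Set.disjoint_left.1 (hdisj (by simpa using hK) (by simpa using hL) hKL)
        (SimpleGraph.Subgraph.mem_edgeSet.2 hu) (SimpleGraph.Subgraph.mem_edgeSet.2 hu')
  refine two_pow_sub_two_not_dvd hk n (hcard ▸ Finset.dvd_sum fun K hK => ?_)
  obtain ⟨φ⟩ := hP K (by simpa using hK)
  exact dvd_card_direction (by omega) φ i

theorem exists_cube_le_puncturedCube (m : ℕ) :
    ∃ K : (cube (m + 1)).Subgraph, K ≤ puncturedCube (m + 1) ∧ Nonempty (cube m ≃g K.coe) := by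
  let f : (Fin m → ZMod 2) → Fin (m + 1) → ZMod 2 := fun x => Fin.cons 1 x
  have hf : Function.Injective f := Fin.cons_right_injective (α := fun _ => ZMod 2) 1
  refine ⟨(⊤ : (cube (m + 1)).Subgraph).induce (Set.range f),
    SimpleGraph.Subgraph.induce_mono_right ?_, ⟨⟨Equiv.ofInjective f hf, ?_⟩⟩⟩
  · rintro _ ⟨x, rfl⟩ h
    simpa [f] using congrFun h 0
  · intro x y
    have h : ((⊤ : (cube (m + 1)).Subgraph).induce (Set.range f)).Adj (f x) (f y) ↔
        (cube (m + 1)).Adj (f x) (f y) := by simp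
    refine h.trans ?_
    rw [cube_adj, cube_adj]
    constructor
    · rintro ⟨i, hi⟩
      induction i using Fin.cases with
      | zero => simpa [f] using congrFun hi 0
      | succ i =>
        refine ⟨i, funext fun t => ?_⟩
        simpa [f, Pi.single_apply] using congrFun hi t.succ
    · rintro ⟨i, rfl⟩
      refine ⟨i.succ, funext fun t => ?_⟩
      induction t using Fin.cases with
      | zero => simp [f, (Fin.succ_ne_zero i).symm]
      | succ t => simp [f, Pi.single_apply]

theorem cube_edge_unpackable (k : ℕ) (hk : 5 ≤ k) :
    ∃ H : (cube k).Subgraph,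
      (∃ K : (cube k).Subgraph, K ≤ H ∧ Nonempty (cube (k - 1) ≃g K.coe)) ∧
      ∀ n : ℕ, 1 ≤ n → ¬ HasPerfectEdgePacking (cube n) H.coe := by
  refine ⟨puncturedCube k, ?_, fun n hn => puncturedCube_not_hasPerfectEdgePacking (by omega) hn⟩
  obtain ⟨m, rfl⟩ : ∃ m, k = m + 1 := ⟨k - 1, by omega⟩
  exact exists_cube_le_puncturedCube m
end

section
/- For every integer k ≥ 5, there exists a subgraph H of the hypercube Q_k with the following four properties: (1) H contains a subgraph isomorphic to Q_{k-1}; (2) for every direction i ∈ {1,...,k}, the number of edges of H with direction i equals 2^{k-1} - 1; (3) every vertex of Q_k has degree at least k - 1 in H; (4) H is stiff. -/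
/-- `E_i(K)`: the set of edges of the subgraph `K` of `Q_n` whose direction is `i`,
i.e. whose endpoints differ in coordinate `i`. -/
def edgesInDir {n : ℕ} (K : (cube n).Subgraph) (i : Fin n) :
    Set (Sym2 (Fin n → ZMod 2)) :=
  {e | e ∈ K.edgeSet ∧ ∃ u v, e = s(u, v) ∧ u i ≠ v i}

/-- `H` is stiff: for every `n ≥ k` and every isomorphism `φ` from `H` to a subgraph `H'`
of `Q_n`, there is a map `f`, injective on the set `D(H)` of directions used by `H`, such
that `φ` sends every edge of `H` of direction `i` to an edge of `H'` of direction `f i`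
(equivalently, `φ(E_i(H)) = E_{f(i)}(H')` for every `i ∈ D(H)`). -/
def Stiff {k : ℕ} (H : (cube k).Subgraph) : Prop :=
  ∀ n : ℕ, k ≤ n → ∀ H' : (cube n).Subgraph, ∀ φ : H.coe ≃g H'.coe,
    ∃ f : Fin k → Fin n,
      Set.InjOn f {i | (edgesInDir H i).Nonempty} ∧
      ∀ u v : H.verts, H.coe.Adj u v → ∀ i : Fin k,
        (u : Fin k → ZMod 2) i ≠ (v : Fin k → ZMod 2) i →
        (φ u : Fin n → ZMod 2) (f i) ≠ (φ v : Fin n → ZMod 2) (f i)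

namespace StiffCube

/-- The `i`-th unit vector of `(ZMod 2)^n`. -/
def unit {n : ℕ} (i : Fin n) : Fin n → ZMod 2 := Pi.single i 1

@[simp] lemma unit_self {n : ℕ} (i : Fin n) : unit i i = 1 := by simp [unit]

lemma unit_of_ne {n : ℕ} {i j : Fin n} (h : j ≠ i) : unit i j = 0 := by simp [unit, h]

lemma unit_eq_ite {n : ℕ} (i j : Fin n) : unit i j = if j = i then 1 else 0 := by
  simp [unit, Pi.single_apply]

lemma unit_injective {n : ℕ} : Function.Injective (unit (n := n)) := by
  intro i j h
  by_contra hij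
  have := congrFun h i
  rw [unit_self, unit_of_ne hij] at this
  exact one_ne_zero this

lemma unit_ne_zero {n : ℕ} (i : Fin n) : unit i ≠ 0 := by
  intro h
  have := congrFun h i
  simp at this

lemma two_eq_zero {n : ℕ} : (2 : Fin n → ZMod 2) = 0 := by
  ext j
  exact (by decide : (2 : ZMod 2) = 0)

lemma add_unit_cancel {n : ℕ} (v : Fin n → ZMod 2) (i : Fin n) :
    v + unit i + unit i = v := by
  linear_combination unit i * two_eq_zero

lemma eq_zero_or_one (x : ZMod 2) : x = 0 ∨ x = 1 := by
  revert x
  decide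

lemma eq_add_one_of_ne {x y : ZMod 2} (h : x ≠ y) : y = x + 1 := by
  revert x y
  decide

lemma eq_add_unit_iff {n : ℕ} {u v : Fin n → ZMod 2} {i : Fin n} :
    v = u + unit i ↔ u i ≠ v i ∧ ∀ j, j ≠ i → u j = v j := by
  constructor
  · rintro rfl
    exact ⟨by simp, fun j hj => by simp [unit_of_ne hj]⟩
  · rintro ⟨h, h'⟩
    ext j
    by_cases hj : j = i
    · subst hj
      simpa using eq_add_one_of_ne h
    · simp [unit_of_ne hj, h' j hj]

lemma cube_adj_iff {n : ℕ} {u v : Fin n → ZMod 2} :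
    (cube n).Adj u v ↔ ∃ i, v = u + unit i := by
  simp only [cube, SimpleGraph.fromRel_adj, eq_add_unit_iff]
  constructor
  · rintro ⟨-, h | ⟨i, h, h'⟩⟩
    · exact h
    · exact ⟨i, h.symm, fun j hj => (h' j hj).symm⟩
  · rintro ⟨i, hne, heq⟩
    exact ⟨fun huv => hne (congrFun huv i), .inl ⟨i, hne, heq⟩⟩

/-- A sum of two unit vectors determines its summands unless it vanishes. -/
lemma unit_add_unit_eq {n : ℕ} {a b c d : Fin n} (hac : a ≠ c)
    (h : unit a + unit b = unit c + unit d) : a = b ∧ c = d ∨ a = d ∧ b = c := by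
  have ha := congrFun h a
  have hb := congrFun h b
  have hc := congrFun h c
  simp only [Pi.add_apply, unit_eq_ite] at ha hb hc
  have : (1 : ZMod 2) + 1 = 0 := by decide
  grind

/-- A `ZMod 2`-vector that is a sum of two unit vectors in three ways with distinct first
summands is zero. -/
lemma eq_of_unit_add_unit_eq {n : ℕ} {p q r x y z : Fin n}
    (hpq : p ≠ q) (hpr : p ≠ r) (hqr : q ≠ r)
    (h₁ : unit p + unit x = unit q + unit y) (h₂ : unit p + unit x = unit r + unit z) :
    p = x := by
  rcases unit_add_unit_eq hpq h₁ with h | h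
  · exact h.1
  · rcases unit_add_unit_eq hpr h₂ with h' | h'
    · exact h'.1
    · exact absurd (h.2.symm.trans h'.2) hqr

/-- Every vertex of the cube can be reached from `b` through steps away from `b`. -/
theorem cube_induction {n : ℕ} {P : (Fin n → ZMod 2) → Prop} (b : Fin n → ZMod 2) (base : P b)
    (step : ∀ v, v ≠ b → ∃ j, v j ≠ b j ∧ (P (v + unit j) → P v)) (v : Fin n → ZMod 2) :
    P v := by
  induction hd : hammingDist v b using Nat.strong_induction_on generalizing v with
  | _ d ih =>
    by_cases hv : v = b
    · exact hv ▸ base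
    obtain ⟨j, hj, hP⟩ := step v hv
    refine hP (ih _ ?_ _ rfl)
    rw [← hd]
    refine Finset.card_lt_card ⟨fun l hl => ?_, fun h => ?_⟩
    · simp only [Finset.mem_filter, Finset.mem_univ, true_and] at hl ⊢
      by_cases hlj : l = j
      · exact hlj ▸ hj
      · simpa [unit_of_ne hlj] using hl
    · have := h (by simpa using hj : j ∈ _)
      simp [eq_add_one_of_ne hj] at this

/-- Opposite edges of a 4-cycle of the cube are parallel. -/
lemma square_closes {n : ℕ} {a b c d : Fin n → ZMod 2} {j l : Fin n}
    (hb : b = a + unit j) (hc : c = a + unit l) (hbc : b ≠ c) (hda : d ≠ a)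
    (hbd : (cube n).Adj b d) (hcd : (cube n).Adj c d) : d = a + unit j + unit l := by
  subst hb hc
  obtain ⟨p, hp⟩ := cube_adj_iff.1 hbd
  obtain ⟨q, hq⟩ := cube_adj_iff.1 hcd
  have hjl : j ≠ l := by
    rintro rfl
    exact hbc rfl
  have h : unit j + unit p = unit l + unit q := by linear_combination hq - hp
  rcases unit_add_unit_eq hjl h with ⟨rfl, -⟩ | ⟨-, rfl⟩
  · exact absurd (hp.trans (add_unit_cancel a j)) hda
  · exact hp

/-- A map of coordinates fixing `0` and having no other points of period at most two. -/
structure IsTwist {n : ℕ} [NeZero n] (σ : Fin n → Fin n) : Prop where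
  injective : Function.Injective σ
  map_zero : σ 0 = 0
  eq_zero_of_sq : ∀ i, σ (σ i) = i → i = 0

namespace IsTwist

variable {n : ℕ} [NeZero n] {σ : Fin n → Fin n}

lemma map_ne_self (hσ : IsTwist σ) {i : Fin n} (hi : i ≠ 0) : σ i ≠ i :=
  fun h => hi (hσ.eq_zero_of_sq i (by rw [h, h]))

lemma map_ne_zero (hσ : IsTwist σ) {i : Fin n} (hi : i ≠ 0) : σ i ≠ 0 :=
  fun h => hi (hσ.injective (h.trans hσ.map_zero.symm))

end IsTwist

lemma exists_isTwist (m : ℕ) (hm : 3 ≤ m) : ∃ σ : Fin (m + 1) → Fin (m + 1), IsTwist σ := by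
  have h1 : ∀ i : Fin (m + 1), (if i.val = 0 then 0 else if i.val = m then 1 else i.val + 1 : ℕ) <
      m + 1 := by
    intro i
    split_ifs <;> omega
  refine ⟨fun i => ⟨_, h1 i⟩, ?_, ?_, ?_⟩
  · intro i j h
    simp only [Fin.mk.injEq] at h
    ext
    split_ifs at h <;> omega
  · ext
    simp
  · intro i h
    have h := congrArg Fin.val h
    simp only at h
    ext
    simp only [Fin.val_zero]
    split_ifs at h <;> omega

section Construction

variable {m : ℕ}

/-- The endpoint, with `i`-th coordinate zero, of the deleted edge of direction `i`. -/
def hole (σ : Fin (m + 1) → Fin (m + 1)) (i : Fin (m + 1)) : Fin (m + 1) → ZMod 2 :=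
  unit 0 + unit (σ i)

/-- The hypercube with one edge of every direction deleted, namely the edge joining `hole σ i`
to `hole σ i + unit i`. -/
def puncturedCube (σ : Fin (m + 1) → Fin (m + 1)) : (cube (m + 1)).Subgraph where
  verts := Set.univ
  Adj u v := ∃ i, v = u + unit i ∧ u ≠ hole σ i ∧ v ≠ hole σ i
  adj_sub := by
    rintro u v ⟨i, h, -⟩
    exact cube_adj_iff.2 ⟨i, h⟩
  edge_vert _ := Set.mem_univ _
  symm := ⟨by
    rintro u v ⟨i, rfl, h, h'⟩
    exact ⟨i, (add_unit_cancel u i).symm, h', h⟩⟩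

variable {σ : Fin (m + 1) → Fin (m + 1)}

lemma puncturedCube_adj {u v : Fin (m + 1) → ZMod 2} :
    (puncturedCube σ).Adj u v ↔ ∃ i, v = u + unit i ∧ u ≠ hole σ i ∧ v ≠ hole σ i := Iff.rfl

lemma hole_zero (hσ : IsTwist σ) : hole σ 0 = 0 := by
  rw [hole, hσ.map_zero]
  linear_combination unit 0 * two_eq_zero

lemma hole_apply_zero (hσ : IsTwist σ) {i : Fin (m + 1)} (hi : i ≠ 0) : hole σ i 0 = 1 := by
  simp [hole, unit_of_ne (hσ.map_ne_zero hi).symm]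

lemma hole_apply_self (hσ : IsTwist σ) (i : Fin (m + 1)) : hole σ i i = 0 := by
  by_cases hi : i = 0
  · rw [hi, hole_zero hσ, Pi.zero_apply]
  · simp [hole, unit_of_ne hi, unit_of_ne (hσ.map_ne_self hi).symm]

/-- The deleted edges are pairwise disjoint. -/
lemma subsingleton_setOf_hole (hσ : IsTwist σ) (v : Fin (m + 1) → ZMod 2) :
    {i | v = hole σ i ∨ v + unit i = hole σ i}.Subsingleton := by
  have mixed : ∀ i j, v = hole σ i → v + unit j = hole σ j → False := by
    intro i j hi hj
    have h : unit (σ i) + unit j = unit (σ j) := by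
      simp only [hole] at hi hj
      linear_combination hj - hi
    have hs := congrArg (fun w : Fin (m + 1) → ZMod 2 => ∑ l, w l) h
    simp [unit, Finset.sum_add_distrib] at hs
  rintro i (hi | hi) j (hj | hj)
  · exact hσ.injective (unit_injective (add_left_cancel (hi.symm.trans hj)))
  · exact (mixed i j hi hj).elim
  · exact (mixed j i hj hi).elim
  · by_contra hij
    have h : unit i + unit (σ i) = unit j + unit (σ j) := by
      simp only [hole] at hi hj
      linear_combination hj - hi + (unit i - unit j) * two_eq_zero
    rcases unit_add_unit_eq hij h with ⟨hi', hj'⟩ | ⟨h₁, h₂⟩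
    · exact hij ((hσ.eq_zero_of_sq i (by rw [← hi', ← hi'])).trans
        (hσ.eq_zero_of_sq j (by rw [← hj', ← hj'])).symm)
    · have hi0 := hσ.eq_zero_of_sq i (by rw [h₂, ← h₁])
      exact hij (hi0.trans (by rw [← h₂, hi0, hσ.map_zero]))

lemma le_ncard_neighborSet (hσ : IsTwist σ) (v : Fin (m + 1) → ZMod 2) :
    m ≤ ((puncturedCube σ).neighborSet v).ncard := by
  set B := {i | v = hole σ i ∨ v + unit i = hole σ i} with hB
  have hN : (puncturedCube σ).neighborSet v = (fun i => v + unit i) '' Bᶜ := by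
    ext w
    simp only [SimpleGraph.Subgraph.mem_neighborSet, puncturedCube_adj, Set.mem_image,
      Set.mem_compl_iff, hB, Set.mem_ofPred_eq, not_or]
    constructor
    · rintro ⟨i, rfl, h⟩
      exact ⟨i, h, rfl⟩
    · rintro ⟨i, h, rfl⟩
      exact ⟨i, rfl, h⟩
  rw [hN, Set.ncard_image_of_injective _ fun i j h => unit_injective (add_left_cancel h)]
  have h₁ : B.ncard ≤ 1 := (Set.ncard_le_one_iff_subsingleton).2 (subsingleton_setOf_hole hσ v)
  have h₂ := Set.ncard_add_ncard_compl B
  rw [Nat.card_eq_fintype_card, Fintype.card_fin] at h₂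
  omega

lemma edgesInDir_puncturedCube (hσ : IsTwist σ) (i : Fin (m + 1)) :
    edgesInDir (puncturedCube σ) i =
      (fun v => s(v, v + unit i)) '' ({v | v i = 0} \ {hole σ i}) := by
  ext e
  constructor
  · rintro ⟨he, u, v, rfl, huv⟩
    obtain ⟨j, rfl, hu, hv⟩ := puncturedCube_adj.1 (SimpleGraph.Subgraph.mem_edgeSet.1 he)
    obtain rfl : i = j := by
      by_contra hij
      simp [unit_of_ne hij] at huv
    rcases eq_zero_or_one (u i) with h | h
    · exact ⟨u, ⟨h, hu⟩, rfl⟩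
    · refine ⟨u + unit i, ⟨?_, hv⟩, ?_⟩
      · simp only [Set.mem_ofPred_eq, Pi.add_apply, h, unit_self]
        decide
      · simp only [add_unit_cancel, Sym2.eq_swap]
  · rintro ⟨v, ⟨hv, hne⟩, rfl⟩
    refine ⟨SimpleGraph.Subgraph.mem_edgeSet.2 (puncturedCube_adj.2 ⟨i, rfl, hne, ?_⟩),
      v, v + unit i, rfl, by simp⟩
    intro h
    have := congrFun h i
    rw [hole_apply_self hσ] at this
    simp [show v i = 0 from hv] at this

lemma ncard_setOf_apply_eq_zero (i : Fin (m + 1)) :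
    {v : Fin (m + 1) → ZMod 2 | v i = 0}.ncard = 2 ^ m := by
  have h : {v : Fin (m + 1) → ZMod 2 | v i = 0} =
      (fun x : Fin m → ZMod 2 => (i.insertNth 0 x : Fin (m + 1) → ZMod 2)) '' Set.univ := by
    ext v
    simp only [Set.mem_ofPred_eq, Set.image_univ, Set.mem_range]
    constructor
    · intro hv
      exact ⟨i.removeNth v, by rw [← hv]; exact Fin.insertNth_self_removeNth i v⟩
    · rintro ⟨x, rfl⟩
      simp
  rw [h, Set.ncard_image_of_injective _ (fun x y hxy => ?_), Set.ncard_univ]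
  · simp
  · exact Fin.insertNth_right_injective _ hxy

lemma ncard_edgesInDir (hσ : IsTwist σ) (i : Fin (m + 1)) :
    (edgesInDir (puncturedCube σ) i).ncard = 2 ^ m - 1 := by
  rw [edgesInDir_puncturedCube hσ, Set.InjOn.ncard_image,
    Set.ncard_sdiff_singleton_of_mem (show hole σ i ∈ {v | v i = 0} from hole_apply_self hσ i),
    ncard_setOf_apply_eq_zero]
  rintro u ⟨hu, -⟩ v ⟨hv, -⟩ h
  rcases Sym2.eq_iff.1 h with ⟨h, -⟩ | ⟨h, -⟩
  · exact h
  · have := congrFun h i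
    simp [show u i = 0 from hu, show v i = 0 from hv] at this

/-- The facet `x 0 = 0` of the cube. -/
def facet (m : ℕ) : (cube (m + 1)).Subgraph := (⊤ : (cube (m + 1)).Subgraph).induce {v | v 0 = 0}

lemma facet_le (hσ : IsTwist σ) : facet m ≤ puncturedCube σ := by
  refine ⟨Set.subset_univ _, ?_⟩
  rintro u v ⟨hu, hv, h⟩
  obtain ⟨i, rfl⟩ := cube_adj_iff.1 h
  have hu : u 0 = 0 := hu
  have hi : i ≠ 0 := by
    rintro rfl
    simp [hu] at hv
  refine puncturedCube_adj.2 ⟨i, rfl, ?_, ?_⟩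
  · intro h
    simp [h, hole_apply_zero hσ hi] at hu
  · intro h
    simp [h, hole_apply_zero hσ hi] at hv

lemma cons_add_unit (x : Fin m → ZMod 2) (i : Fin m) :
    (Fin.cons 0 (x + unit i) : Fin (m + 1) → ZMod 2) = Fin.cons 0 x + unit i.succ := by
  ext j
  refine Fin.cases ?_ (fun l => ?_) j
  · simp [unit_of_ne (Fin.succ_ne_zero i).symm]
  · simp [unit_eq_ite]

/-- The facet `x 0 = 0` is a cube of dimension one less. -/
def cubeIsoFacet (m : ℕ) : cube m ≃g (facet m).coe where
  toFun x := ⟨Fin.cons 0 x, by simp [facet]⟩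
  invFun v := Fin.tail v.1
  left_inv x := Fin.tail_cons _ _
  right_inv := by
    rintro ⟨v, hv⟩
    have hv : v 0 = 0 := hv
    simp [← hv]
  map_rel_iff' := by
    intro x y
    rw [cube_adj_iff]
    constructor
    · rintro ⟨-, -, h⟩
      obtain ⟨i, hi⟩ := cube_adj_iff.1 h
      change (Fin.cons 0 y : Fin (m + 1) → ZMod 2) = Fin.cons 0 x + unit i at hi
      obtain ⟨l, rfl⟩ : ∃ l : Fin m, l.succ = i := by
        refine Fin.exists_succ_eq.2 ?_
        rintro rfl
        have := congrFun hi 0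
        simp at this
      rw [← cons_add_unit] at hi
      exact ⟨l, Fin.cons_right_injective _ hi⟩
    · rintro ⟨i, rfl⟩
      exact ⟨rfl, rfl, cube_adj_iff.2 ⟨i.succ, cons_add_unit x i⟩⟩

section Rigidity

variable {n : ℕ} {φ : (Fin (m + 1) → ZMod 2) → (Fin n → ZMod 2)}

lemma facet_adj {v : Fin (m + 1) → ZMod 2} {i : Fin (m + 1)} (hv : v 0 = 0) (hi : i ≠ 0) :
    (facet m).Adj v (v + unit i) :=
  ⟨hv, by simp [hv, unit_of_ne hi.symm], cube_adj_iff.2 ⟨i, rfl⟩⟩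

/-- An embedding of the facet `x 0 = 0` into a cube preserves parallelism. -/
lemma exists_direction_facet (hφ : Function.Injective φ)
    (hadj : ∀ u v, (facet m).Adj u v → (cube n).Adj (φ u) (φ v)) :
    ∃ f : Fin (m + 1) → Fin n, ∀ v, v 0 = 0 → ∀ i, i ≠ 0 →
      φ (v + unit i) = φ v + unit (f i) := by
  have h0 : ∀ i : Fin (m + 1), ∃ j : Fin n, i ≠ 0 → φ (0 + unit i) = φ 0 + unit j := by
    intro i
    by_cases hi : i = 0
    · have hne : (0 : Fin (m + 1) → ZMod 2) ≠ unit 0 := (unit_ne_zero 0).symm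
      obtain ⟨l, -⟩ := Function.ne_iff.1 (hφ.ne hne)
      exact ⟨l, fun h => absurd hi h⟩
    · obtain ⟨j, hj⟩ := cube_adj_iff.1 (hadj _ _ (facet_adj (v := 0) rfl hi))
      exact ⟨j, fun _ => hj⟩
  choose f hf using h0
  refine ⟨f, fun v => cube_induction
    (P := fun v => v 0 = 0 → ∀ i, i ≠ 0 → φ (v + unit i) = φ v + unit (f i)) 0
    (fun _ => hf) (fun v hv => ?_) v⟩
  obtain ⟨j, hj⟩ := Function.ne_iff.1 hv
  refine ⟨j, hj, fun ih hv0 i hi => ?_⟩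
  have hj0 : j ≠ 0 := by
    rintro rfl
    exact hj hv0
  set u := v + unit j with hu
  have hvu : v = u + unit j := (add_unit_cancel v j).symm
  have hu0 : u 0 = 0 := by simp [hu, hv0, unit_of_ne hj0.symm]
  have hφv : φ v = φ u + unit (f j) := hvu ▸ ih hu0 j hj0
  by_cases hij : i = j
  · subst hij
    rw [← hu, hφv, add_unit_cancel]
  have hcomm : v + unit i = u + unit i + unit j := by rw [hvu]; abel
  rw [hφv]
  refine square_closes hφv (ih hu0 i hi) (hφ.ne ?_) (hφ.ne ?_)
    (hadj _ _ (facet_adj hv0 hi)) (hadj _ _ ?_)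
  · rw [hvu]
    exact fun h => hij (unit_injective (add_left_cancel h)).symm
  · intro h
    rw [hvu, add_assoc] at h
    have h := add_eq_left.1 h
    have := congrFun h i
    simp [unit_of_ne hij] at this
  · rw [hcomm]
    exact facet_adj (by simp [hu0, unit_of_ne hi.symm]) hj0

/-- From a nonzero vertex `v` of the facet `x 0 = 0` other than the farthest one, one can move away
from zero so that the parallel edge of the opposite facet has not been deleted. -/
lemma exists_ascent (hσ : IsTwist σ) {v : Fin (m + 1) → ZMod 2} (hv0 : v 0 = 0) (hv : v ≠ 0)
    (hv1 : v ≠ 1 + unit 0) : ∃ j, j ≠ 0 ∧ v j = 0 ∧ v ≠ unit (σ j) := by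
  by_cases h : ∃ l, v = unit l
  · obtain ⟨l, rfl⟩ := h
    have hl : l ≠ 0 := by
      rintro rfl
      simp at hv0
    exact ⟨σ l, hσ.map_ne_zero hl, unit_of_ne (hσ.map_ne_self hl),
      fun h => hl (hσ.eq_zero_of_sq l (unit_injective h).symm)⟩
  · obtain ⟨j, hj⟩ := Function.ne_iff.1 hv1
    have hj0 : j ≠ 0 := by
      rintro rfl
      rw [hv0] at hj
      exact hj (by simp only [Pi.add_apply, Pi.one_apply, unit_self]; decide)
    refine ⟨j, hj0, ?_, fun h' => h ⟨_, h'⟩⟩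
    simp only [Pi.add_apply, Pi.one_apply, unit_of_ne hj0, add_zero] at hj
    exact (eq_zero_or_one _).resolve_right hj

lemma adj_cross (hσ : IsTwist σ) {v : Fin (m + 1) → ZMod 2} (hv0 : v 0 = 0) (hv : v ≠ 0) :
    (puncturedCube σ).Adj v (v + unit 0) := by
  refine puncturedCube_adj.2 ⟨0, rfl, ?_, ?_⟩
  · rwa [hole_zero hσ]
  · rw [hole_zero hσ]
    intro h
    have := congrFun h 0
    simp [hv0] at this

lemma adj_opposite (hσ : IsTwist σ) {v : Fin (m + 1) → ZMod 2} {j : Fin (m + 1)} (hj : j ≠ 0)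
    (hvj : v j = 0) (hv : v ≠ unit (σ j)) :
    (puncturedCube σ).Adj (v + unit 0) (v + unit 0 + unit j) := by
  refine puncturedCube_adj.2 ⟨j, rfl, ?_, ?_⟩
  · intro h
    exact hv (add_left_cancel ((add_comm _ _).trans h))
  · intro h
    have := congrFun h j
    rw [hole_apply_self hσ] at this
    simp [hvj, unit_of_ne hj] at this

/-- All edges crossing between the two facets, except possibly the deleted one, are mapped to
parallel edges. -/
lemma exists_direction_cross (hσ : IsTwist σ) (hφ : Function.Injective φ)
    (hadj : ∀ u v, (puncturedCube σ).Adj u v → (cube n).Adj (φ u) (φ v))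
    (hm : 1 ≤ m) {f : Fin (m + 1) → Fin n}
    (hf : ∀ v, v 0 = 0 → ∀ i, i ≠ 0 → φ (v + unit i) = φ v + unit (f i)) :
    ∃ c : Fin n, ∀ v, v 0 = 0 → v ≠ 0 → φ (v + unit 0) = φ v + unit c := by
  have hb0 : (1 + unit 0 : Fin (m + 1) → ZMod 2) 0 = 0 := by
    simp only [Pi.add_apply, Pi.one_apply, unit_self]
    decide
  have hb : (1 + unit 0 : Fin (m + 1) → ZMod 2) ≠ 0 := by
    intro h
    have := congrFun h (Fin.last m)
    simp [unit_of_ne (i := 0) (j := Fin.last m) (by simp [Fin.ext_iff]; omega)] at this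
  obtain ⟨c, hc⟩ := cube_adj_iff.1 (hadj _ _ (adj_cross hσ hb0 hb))
  refine ⟨c, fun v => cube_induction
    (P := fun v => v 0 = 0 → v ≠ 0 → φ (v + unit 0) = φ v + unit c) (1 + unit 0)
    (fun _ _ => hc) (fun v hvb => ?_) v⟩
  by_cases hv : v 0 = 0 ∧ v ≠ 0
  swap
  · obtain ⟨j, hj⟩ := Function.ne_iff.1 hvb
    exact ⟨j, hj, fun _ h h' => absurd ⟨h, h'⟩ hv⟩
  obtain ⟨hv0, hv⟩ := hv
  obtain ⟨j, hj0, hvj, hvσ⟩ := exists_ascent hσ hv0 hv hvb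
  refine ⟨j, by simp [hvj, unit_of_ne hj0], fun ih _ _ => ?_⟩
  set u := v + unit j with hu
  have hvu : v = u + unit j := (add_unit_cancel v j).symm
  have hu0 : u 0 = 0 := by simp [hu, hv0, unit_of_ne hj0.symm]
  have hune : u ≠ 0 := by
    intro h
    have := congrFun h j
    simp [hu, hvj] at this
  have hφv : φ v = φ u + unit (f j) := hvu ▸ hf u hu0 j hj0
  have hcomm : u + unit 0 = v + unit 0 + unit j := by rw [hu]; abel
  rw [hφv]
  refine square_closes hφv (ih hu0 hune) (hφ.ne ?_) (hφ.ne ?_)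
    (hadj _ _ (adj_cross hσ hv0 hv)) (hadj _ _ ?_)
  · rw [hvu]
    exact fun h => hj0 (unit_injective (add_left_cancel h))
  · intro h
    have := congrFun h 0
    simp [hv0, hu0] at this
  · rw [hcomm]
    exact (adj_opposite hσ hj0 hvj hvσ).symm

lemma adj_unit_zero (hσ : IsTwist σ) {i : Fin (m + 1)} (hi : i ≠ 0) :
    (puncturedCube σ).Adj (unit 0) (unit i + unit 0) := by
  refine puncturedCube_adj.2 ⟨i, add_comm _ _, ?_, ?_⟩
  · intro h
    exact unit_ne_zero (σ i) (left_eq_add.1 h)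
  · intro h
    exact hσ.map_ne_self hi (unit_injective (add_left_cancel ((add_comm _ _).trans h))).symm

/-- An embedding of the punctured cube into a cube is affine. -/
theorem exists_direction (hσ : IsTwist σ) (hm : 3 ≤ m) (hφ : Function.Injective φ)
    (hadj : ∀ u v, (puncturedCube σ).Adj u v → (cube n).Adj (φ u) (φ v)) :
    ∃ f : Fin (m + 1) → Fin n, Function.Injective f ∧
      ∀ v i, φ (v + unit i) = φ v + unit (f i) := by
  obtain ⟨f, hf⟩ := exists_direction_facet hφ fun u v h => hadj u v ((facet_le hσ).2 h)
  obtain ⟨c, hc⟩ := exists_direction_cross hσ hφ hadj (by omega) hf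
  have hunit0 : ∀ i : Fin (m + 1), i ≠ 0 → unit i 0 = 0 := fun i hi => unit_of_ne hi.symm
  have hf0 : ∀ i, i ≠ 0 → φ (unit i) = φ 0 + unit (f i) := fun i hi => by
    simpa using hf 0 rfl i hi
  have hfinj : ∀ i j, i ≠ 0 → j ≠ 0 → f i = f j → i = j := fun i j hi hj h =>
    unit_injective (hφ (by rw [hf0 i hi, hf0 j hj, h]))
  have hzero : φ (unit 0) = φ 0 + unit c := by
    have key : ∀ i, i ≠ 0 → ∃ x, φ (unit 0) + φ 0 + unit c = unit (f i) + unit x := by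
      intro i hi
      obtain ⟨x, hx⟩ := cube_adj_iff.1 (hadj _ _ (adj_unit_zero hσ hi))
      rw [hc _ (hunit0 i hi) (unit_ne_zero i), hf0 i hi] at hx
      exact ⟨x, by linear_combination -hx + (φ 0 + unit c - unit x) * two_eq_zero⟩
    have h1 : (⟨1, by omega⟩ : Fin (m + 1)) ≠ 0 := by simp [Fin.ext_iff]
    have h2 : (⟨2, by omega⟩ : Fin (m + 1)) ≠ 0 := by simp [Fin.ext_iff]
    have h3 : (⟨3, by omega⟩ : Fin (m + 1)) ≠ 0 := by simp [Fin.ext_iff]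
    obtain ⟨x, hx⟩ := key _ h1
    obtain ⟨y, hy⟩ := key _ h2
    obtain ⟨z, hz⟩ := key _ h3
    have hfx := eq_of_unit_add_unit_eq
      (fun h => by simpa [Fin.ext_iff] using hfinj _ _ h1 h2 h)
      (fun h => by simpa [Fin.ext_iff] using hfinj _ _ h1 h3 h)
      (fun h => by simpa [Fin.ext_iff] using hfinj _ _ h2 h3 h)
      (hx.symm.trans hy) (hx.symm.trans hz)
    rw [← hfx] at hx
    linear_combination hx + (unit (f ⟨1, by omega⟩) - φ 0 - unit c) * two_eq_zero
  have hcross : ∀ v, v 0 = 0 → φ (v + unit 0) = φ v + unit c := by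
    intro v hv
    by_cases hv' : v = 0
    · simpa [hv'] using hzero
    · exact hc v hv hv'
  have hcf : ∀ i, i ≠ 0 → f i ≠ c := by
    intro i hi h
    exact hi (unit_injective (hφ (by rw [hf0 i hi, hzero, h])))
  refine ⟨Function.update f 0 c, ?_, ?_⟩
  · intro i j h
    by_cases hi : i = 0 <;> by_cases hj : j = 0
    · rw [hi, hj]
    · subst hi
      simp only [Function.update_self, Function.update_of_ne hj] at h
      exact absurd h.symm (hcf j hj)
    · subst hj
      simp only [Function.update_self, Function.update_of_ne hi] at h
      exact absurd h (hcf i hi)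
    · simp only [Function.update_of_ne hi, Function.update_of_ne hj] at h
      exact hfinj i j hi hj h
  · intro v i
    rcases eq_zero_or_one (v 0) with hv | hv
    · by_cases hi : i = 0
      · subst hi
        simpa using hcross v hv
      · simpa [Function.update_of_ne hi] using hf v hv i hi
    · obtain ⟨u, hu, rfl⟩ : ∃ u : Fin (m + 1) → ZMod 2, u 0 = 0 ∧ u + unit 0 = v := by
        refine ⟨v + unit 0, ?_, add_unit_cancel v 0⟩
        simp only [Pi.add_apply, hv, unit_self]
        decide
      by_cases hi : i = 0
      · subst hi
        rw [add_unit_cancel, Function.update_self, hcross u hu, add_unit_cancel]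
      · rw [Function.update_of_ne hi, hcross u hu, add_right_comm,
          hcross _ (by simp [hu, hunit0 i hi]), hf u hu i hi, add_right_comm]

theorem stiff_puncturedCube (hσ : IsTwist σ) (hm : 3 ≤ m) : Stiff (puncturedCube σ) := by
  intro n _ H' φ
  obtain ⟨f, hf, hdir⟩ := exists_direction (φ := fun v => (φ ⟨v, Set.mem_univ v⟩).1) hσ hm
    (fun u v h => congrArg Subtype.val (φ.injective (Subtype.ext h)))
    (fun u v h => H'.adj_sub (φ.map_adj_iff.2 h))
  refine ⟨f, hf.injOn, ?_⟩
  rintro ⟨u, hu⟩ ⟨v, hv⟩ h i hi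
  obtain ⟨j, rfl, -⟩ := puncturedCube_adj.1 h
  obtain rfl : i = j := by
    by_contra hij
    simp [unit_of_ne hij] at hi
  have := congrFun (hdir u i) (f i)
  intro h'
  rw [← h'] at this
  simp at this

end Rigidity

end Construction

end StiffCube

open StiffCube in
theorem exists_stiff_subgraph (k : ℕ) (hk : 5 ≤ k) :
    ∃ H : (cube k).Subgraph,
      (∃ K : (cube k).Subgraph, K ≤ H ∧ Nonempty (cube (k - 1) ≃g K.coe)) ∧
      (∀ i : Fin k, (edgesInDir H i).ncard = 2 ^ (k - 1) - 1) ∧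
      (∀ v : Fin k → ZMod 2, k - 1 ≤ (H.neighborSet v).ncard) ∧
      Stiff H := by
  obtain ⟨m, rfl⟩ : ∃ m, k = m + 1 := ⟨k - 1, by omega⟩
  obtain ⟨σ, hσ⟩ := exists_isTwist m (by omega)
  exact ⟨puncturedCube σ, ⟨facet m, facet_le hσ, ⟨cubeIsoFacet m⟩⟩, ncard_edgesInDir hσ,
    le_ncard_neighborSet hσ, stiff_puncturedCube hσ (by omega)⟩
end
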